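/- arXiv:0709.0117 — 4 statements merged into one kernel-verified Lean document; each statement's English description precedes it below -/
import Mathlib

section
/- Let f : (ℂ^n,0) → (ℂ,0) be a germ of holomorphic function whose initial homogeneous term f_m has an isolated singularity at the origin, i.e. the partial derivatives of f_m have no common zero in ℂ^n other than 0. Then the origin is an isolated singularity of f itself: there is a neighborhood of 0 on which the gradient (∂f/∂z₁,…,∂f/∂z_n) vanishes only at 0. -/
open scoped Topology

set_option synthInstance.maxHeartbeats 1000000
set_option maxHeartbeats 1000000

noncomputable section

/-- `ℂⁿ` with the Euclidean norm. -/
abbrev En (n : ℕ) := EuclideanSpace ℂ (Fin n)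

instance germAlgebra {α : Type*} (l : Filter α) : Algebra ℂ (Filter.Germ l ℂ) :=
  ((Filter.Germ.coeRingHom l).comp (Pi.constRingHom α ℂ)).toAlgebra

/-- The ring `𝒪ₙ` of germs at `0` of holomorphic functions on `ℂⁿ`. -/
def AnalyticGerms (n : ℕ) : Subalgebra ℂ ((𝓝 (0 : En n)).Germ ℂ) where
  carrier := {g | ∃ f : En n → ℂ, AnalyticAt ℂ f 0 ∧ g = (f : (𝓝 (0 : En n)).Germ ℂ)}
  add_mem' := by
    rintro a b ⟨f, hf, rfl⟩ ⟨g, hg, rfl⟩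
    exact ⟨f + g, hf.add hg, rfl⟩
  mul_mem' := by
    rintro a b ⟨f, hf, rfl⟩ ⟨g, hg, rfl⟩
    exact ⟨f * g, hf.mul hg, rfl⟩
  algebraMap_mem' := fun c => ⟨fun _ => c, analyticAt_const, rfl⟩

/-- The germ at `0` of the `i`-th partial derivative `∂f/∂zᵢ` of `f`. -/
def partialGerm {n : ℕ} (f : En n → ℂ) (i : Fin n) : (𝓝 (0 : En n)).Germ ℂ :=
  (↑(fun z => fderiv ℂ f z (EuclideanSpace.single i 1)) : (𝓝 (0 : En n)).Germ ℂ)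

/-- The Jacobian ideal `⟨∂f/∂z₁, …, ∂f/∂zₙ⟩` of `f` in the ring `𝒪ₙ` of holomorphic
germs at `0`. -/
def jacobianIdeal {n : ℕ} (f : En n → ℂ) : Ideal (AnalyticGerms n) :=
  Ideal.span {g : AnalyticGerms n | ∃ i : Fin n, (g : (𝓝 (0 : En n)).Germ ℂ) = partialGerm f i}

/-- The Milnor number `μ_f` of `f` at the origin: the complex dimension of
`𝒪ₙ/⟨∂f/∂z₁, …, ∂f/∂zₙ⟩`. -/
def milnorNumber {n : ℕ} (f : En n → ℂ) : ℕ :=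
  Module.finrank ℂ ((AnalyticGerms n) ⧸ jacobianIdeal f)

/-- `f` has algebraic multiplicity `ν` with initial homogeneous term `P`:
in the Taylor expansion `f = f_ν + f_{ν+1} + ⋯` of `f` at `0`, the homogeneous
components of degree `< ν` vanish and the one of degree `ν` is `P ≠ 0`. -/
def HasInitialTerm {n : ℕ} (f : En n → ℂ) (ν : ℕ) (P : En n → ℂ) : Prop :=
  ∃ p : FormalMultilinearSeries ℂ (En n) ℂ, HasFPowerSeriesAt f p 0 ∧
    (∀ k < ν, ∀ z : En n, (p k fun _ => z) = 0) ∧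
    (∀ z : En n, P z = p ν fun _ => z) ∧ P ≠ 0

/-- The origin is an isolated singularity of `f`: the gradient of `f` vanishes at `0`
and at no other point of some neighborhood of `0`. -/
def IsolatedSingularityAt0 {n : ℕ} (f : En n → ℂ) : Prop :=
  fderiv ℂ f 0 = 0 ∧ ∃ U ∈ 𝓝 (0 : En n), ∀ z ∈ U, z ≠ 0 → fderiv ℂ f z ≠ 0

/-- The germs at `0` of the hypersurfaces `V_f = f⁻¹(0)` and `V_g = g⁻¹(0)` are
topologically equisingular: some homeomorphism between neighborhoods of `0`
fixes `0` and sends `f⁻¹(0) ∩ U` onto `g⁻¹(0) ∩ U'`. -/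
def TopEquisingular {n : ℕ} (f g : En n → ℂ) : Prop :=
  ∃ U U' : Set (En n), U ∈ 𝓝 (0 : En n) ∧ U' ∈ 𝓝 (0 : En n) ∧
    ∃ φ ψ : En n → En n, φ 0 = 0 ∧ ContinuousOn φ U ∧ ContinuousOn ψ U' ∧
      Set.MapsTo φ U U' ∧ Set.MapsTo ψ U' U ∧
      (∀ z ∈ U, ψ (φ z) = z) ∧ (∀ z ∈ U', φ (ψ z) = z) ∧
      φ '' (f ⁻¹' {0} ∩ U) = g ⁻¹' {0} ∩ U'

/-- `φ` is a germ of homeomorphism of `(X, 0)`: a homeomorphism between neighborhoods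
of `0` fixing `0`. -/
def IsGermHomeoAt0 {X : Type*} [TopologicalSpace X] [Zero X] (φ : X → X) : Prop :=
  ∃ U V : Set X, U ∈ 𝓝 (0 : X) ∧ V ∈ 𝓝 (0 : X) ∧ φ 0 = 0 ∧ ContinuousOn φ U ∧
    Set.MapsTo φ U V ∧ ∃ ψ : X → X, ContinuousOn ψ V ∧ Set.MapsTo ψ V U ∧
      (∀ x ∈ U, ψ (φ x) = x) ∧ (∀ y ∈ V, φ (ψ y) = y)

/-- `f` and `g` are topologically right-left equivalent:
`f = ψ ∘ g ∘ φ` near `0` for germs of homeomorphisms `φ` of `(ℂⁿ,0)` and `ψ` of `(ℂ,0)`. -/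
def TopRightLeftEquiv {n : ℕ} (f g : En n → ℂ) : Prop :=
  ∃ φ : En n → En n, ∃ ψ : ℂ → ℂ, IsGermHomeoAt0 φ ∧ IsGermHomeoAt0 ψ ∧
    ∀ᶠ z in 𝓝 (0 : En n), f z = ψ (g (φ z))

/-- Evaluation of a polynomial in `n` variables at a point of `ℂⁿ`. -/
def evalE {n : ℕ} (f : MvPolynomial (Fin n) ℂ) : En n → ℂ :=
  fun z => MvPolynomial.eval (fun i => z i) f

section Analysis

variable {E : Type*} [NormedAddCommGroup E] [NormedSpace ℂ E]

/-- Cauchy estimate: if `R` is `O(‖z‖ ^ k)` and holomorphic near `0`, then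
`‖fderiv ℂ R z‖ * ‖z‖` is `O(‖z‖ ^ k)`. -/
theorem exists_norm_fderiv_mul_norm_le_of_isBigO {R : E → ℂ} {k : ℕ}
    (hd : ∀ᶠ z in 𝓝 (0 : E), DifferentiableAt ℂ R z)
    (hR : R =O[𝓝 0] fun z => ‖z‖ ^ k) :
    ∃ C > 0, ∀ᶠ z in 𝓝 (0 : E), ‖fderiv ℂ R z‖ * ‖z‖ ≤ C * ‖z‖ ^ k := by
  obtain ⟨C, hC, hb⟩ := hR.exists_pos
  obtain ⟨r, hr, hball⟩ := Metric.eventually_nhds_iff_ball.1 (hd.and hb.bound)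
  refine ⟨C * 2 ^ k, by positivity, ?_⟩
  filter_upwards [Metric.ball_mem_nhds (0 : E) (half_pos hr)] with z hz
  rw [mem_ball_zero_iff] at hz
  rcases eq_or_ne z 0 with rfl | hz0
  · simp only [norm_zero, mul_zero]; positivity
  have hzpos : 0 < ‖z‖ := norm_pos_iff.2 hz0
  rw [← le_div_iff₀ hzpos]
  refine ContinuousLinearMap.opNorm_le_of_unit_norm (𝕜 := ℂ) (by positivity) fun v hv => ?_
  have hmem : ∀ t : ℂ, ‖t‖ ≤ ‖z‖ → ‖z + t • v‖ ≤ 2 * ‖z‖ := fun t ht => by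
    calc ‖z + t • v‖ ≤ ‖z‖ + ‖t • v‖ := norm_add_le _ _
      _ ≤ 2 * ‖z‖ := by rw [norm_smul, hv]; linarith
  have hline : ∀ t : ℂ, HasDerivAt (fun s : ℂ => z + s • v) v t := fun t => by
    simpa using ((hasDerivAt_id t).smul_const v).const_add z
  have hderiv : ∀ t : ℂ, ‖t‖ ≤ ‖z‖ →
      HasDerivAt (fun s : ℂ => R (z + s • v)) (fderiv ℂ R (z + t • v) v) t := fun t ht =>
    (hball _ (by rw [mem_ball_zero_iff]; linarith [hmem t ht])).1.hasFDerivAt.comp_hasDerivAt t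
      (hline t)
  have key := Complex.norm_deriv_le_of_forall_mem_sphere_norm_le (c := 0)
    (f := fun s : ℂ => R (z + s • v)) (C := C * (2 * ‖z‖) ^ k) hzpos
    (DifferentiableOn.diffContOnCl fun t ht => by
      rw [closure_ball _ hzpos.ne', mem_closedBall_zero_iff] at ht
      exact (hderiv t ht).differentiableAt.differentiableWithinAt)
    (fun t ht => by
      have ht' : ‖t‖ ≤ ‖z‖ := (mem_sphere_zero_iff_norm.1 ht).le
      refine (hball _ (by rw [mem_ball_zero_iff]; linarith [hmem t ht'])).2.trans ?_
      rw [norm_pow, norm_norm]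
      gcongr
      exact hmem t ht')
  rw [(hderiv 0 (by simp)).deriv, zero_smul, add_zero, mul_pow, ← mul_assoc] at key
  exact key

/-- The differential of a homogeneous function of degree `m` whose only critical point is `0`
is bounded below, after multiplication by `‖z‖`, by a positive multiple of `‖z‖ ^ m`. -/
theorem exists_le_norm_fderiv_mul_norm_of_homogeneous [FiniteDimensional ℂ E] {P : E → ℂ} {m : ℕ}
    (hP : ContDiff ℂ 1 P) (hom : ∀ (c : ℂ) (z : E), P (c • z) = c ^ m * P z)
    (hcrit : ∀ z : E, fderiv ℂ P z = 0 → z = 0) :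
    ∃ c > 0, ∀ z : E, z ≠ 0 → c * ‖z‖ ^ m ≤ ‖fderiv ℂ P z‖ * ‖z‖ := by
  have : ProperSpace E := FiniteDimensional.proper ℂ E
  have hpos : ∀ w ∈ Metric.sphere (0 : E) 1, 0 < ‖fderiv ℂ P w‖ := fun w hw =>
    norm_pos_iff.2 fun h => by simp [hcrit w h] at hw
  obtain ⟨c, hc, hle⟩ := (isCompact_sphere (0 : E) 1).exists_forall_le'
    (hP.continuous_fderiv one_ne_zero).norm.continuousOn hpos
  refine ⟨c, hc, fun z hz => ?_⟩
  have hzn : ‖z‖ ≠ 0 := norm_ne_zero_iff.2 hz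
  set w : E := ((‖z‖ : ℂ)⁻¹) • z with hw
  have hw1 : ‖w‖ = 1 := by rw [hw, norm_smul]; simp [hzn]
  have hzw : (‖z‖ : ℂ) • w = z := by
    rw [hw, smul_inv_smul₀ (by exact_mod_cast hzn)]
  have hfd : (‖z‖ : ℂ) • fderiv ℂ P z = (‖z‖ : ℂ) ^ m • fderiv ℂ P w := by
    have h := fderiv_comp_smul (𝕜 := ℂ) (f := P) (x := w) (‖z‖ : ℂ)
    rw [hzw] at h
    rw [← h, ← fderiv_const_smul (hP.differentiable one_ne_zero w)]
    congr 1
    ext x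
    simpa using hom (‖z‖ : ℂ) x
  have hn := congrArg norm hfd
  simp only [norm_smul, norm_pow, Complex.norm_real, norm_norm] at hn
  rw [mul_comm ‖fderiv ℂ P z‖, hn, mul_comm]
  exact mul_le_mul_of_nonneg_left (hle w (by simpa using hw1)) (by positivity)

end Analysis

theorem isolated_of_isolated_initial {n : ℕ}
    (f : En n → ℂ) (hf : AnalyticAt ℂ f 0) (hf0 : f 0 = 0)
    -- `f` has algebraic multiplicity `m` with initial homogeneous term `P`
    (m : ℕ) (P : En n → ℂ) (hfi : HasInitialTerm f m P)
    -- the partial derivatives of `P` have no common zero other than `0`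
    (hP : ∀ z : En n, fderiv ℂ P z = 0 → z = 0) :
    ∃ U ∈ 𝓝 (0 : En n), ∀ z ∈ U, fderiv ℂ f z = 0 → z = 0 := by
  obtain ⟨p, hp, hlow, hPp, -⟩ := hfi
  have hPeq : P = fun z => p m fun _ => z := funext hPp
  have hPdiff : ContDiff ℂ 1 P := by
    rw [hPeq]
    exact (p m).contDiff.comp (contDiff_pi.2 fun _ => contDiff_id)
  have hom : ∀ (c : ℂ) (z : En n), P (c • z) = c ^ m * P z := fun c z => by
    simp [hPp, (p m).map_smul_univ (fun _ => c) fun _ => z]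
  obtain ⟨c, hc, hlower⟩ := exists_le_norm_fderiv_mul_norm_of_homogeneous hPdiff hom hP
  have hfd : ∀ᶠ z in 𝓝 (0 : En n), DifferentiableAt ℂ f z :=
    hf.eventually_analyticAt.mono fun _ h => h.differentiableAt
  have hPd : Differentiable ℂ P := hPdiff.differentiable one_ne_zero
  have hbig : (fun z => f z - P z) =O[𝓝 0] fun z : En n => ‖z‖ ^ (m + 1) := by
    refine (hp.isBigO_sub_partialSum_pow (m + 1)).congr_left fun z => ?_
    rw [zero_add, FormalMultilinearSeries.partialSum, Finset.sum_range_succ,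
      Finset.sum_eq_zero fun k hk => hlow k (Finset.mem_range.1 hk) z, zero_add, hPp]
  obtain ⟨C, hC, hupper⟩ := exists_norm_fderiv_mul_norm_le_of_isBigO
    (hfd.mono fun z hz => hz.sub (hPd z)) hbig
  refine ⟨_, (hfd.and hupper).and (Metric.ball_mem_nhds 0 (div_pos hc hC)), ?_⟩
  rintro z ⟨⟨hz, hle⟩, hzb⟩ hfz
  by_contra hz0
  rw [fderiv_sub hz (hPd z), hfz, zero_sub, norm_neg] at hle
  have hzpos : 0 < ‖z‖ := norm_pos_iff.2 hz0
  have h := (hlower z hz0).trans hle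
  rw [pow_succ, ← mul_assoc, mul_right_comm] at h
  have h' := le_of_mul_le_mul_right h (by positivity)
  have hzb' : ‖z‖ < c / C := mem_ball_zero_iff.1 hzb
  rw [lt_div_iff₀ hC] at hzb'
  linarith
end
end

section
/- Let f : (ℂ^n,0) → (ℂ,0) be a germ of holomorphic function of algebraic multiplicity k whose initial homogeneous term f_k has an isolated singularity at the origin. Then the Milnor number of f at the origin equals the Milnor number of its initial homogeneous term: μ_f = μ_{f_k}; consequently, for every t ∈ [0,1] the function H_t = f_k + t f_{k+1} + t² f_{k+2} + ⋯ has the same Milnor number at the origin as f, so (H_t)_{t∈[0,1]} is a μ-constant family joining f_k and f. -/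
open scoped Topology

set_option synthInstance.maxHeartbeats 1000000
set_option maxHeartbeats 1000000

noncomputable section

section RegularSequences

variable {R : Type*} [CommRing R]

theorem Ideal.mem_sup_span_singleton_iff {J : Ideal R} {x y : R} :
    x ∈ J ⊔ Ideal.span {y} ↔ ∃ b, x - b * y ∈ J := by
  rw [sup_comm, Ideal.mem_span_singleton_sup]
  constructor
  · rintro ⟨a, b, hb, rfl⟩
    exact ⟨a, by simpa using hb⟩
  · rintro ⟨b, hb⟩
    exact ⟨b, _, hb, by ring⟩

/-- `x` is a non-zero-divisor modulo the ideal `J`. -/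
def RegularMod (J : Ideal R) (x : R) : Prop := ∀ a, x * a ∈ J → a ∈ J

/-- The ideal `I` contains a (weakly) regular sequence of length `r` on `R ⧸ J`. -/
def HasRegularSeq (I : Ideal R) : ℕ → Ideal R → Prop
  | 0, _ => True
  | r + 1, J => ∃ x ∈ I, RegularMod J x ∧ HasRegularSeq I r (J ⊔ Ideal.span {x})

/-- No element of `R ⧸ J` other than zero is annihilated by `V`. -/
def NoTorsionMod (V : Set R) (J : Ideal R) : Prop := ∀ a, (∀ v ∈ V, v * a ∈ J) → a ∈ J

theorem RegularMod.swap {J : Ideal R} {x y : R} (hx : RegularMod J x)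
    (hxy : RegularMod (J ⊔ Ideal.span {x}) y) :
    RegularMod (J ⊔ Ideal.span {y}) x := by
  intro a ha
  obtain ⟨b, hb⟩ := Ideal.mem_sup_span_singleton_iff.1 ha
  have hb' : b ∈ J ⊔ Ideal.span {x} := hxy b <| Ideal.mem_sup_span_singleton_iff.2
    ⟨a, by convert J.neg_mem hb using 1; ring⟩
  obtain ⟨c, hc⟩ := Ideal.mem_sup_span_singleton_iff.1 hb'
  refine Ideal.mem_sup_span_singleton_iff.2 ⟨c, hx _ ?_⟩
  convert J.add_mem hb (J.mul_mem_left y hc) using 1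
  ring

theorem mul_mem_of_mem_span {V : Set R} {J : Ideal R} {a x : R} (h : ∀ v ∈ V, v * a ∈ J)
    (hx : x ∈ Ideal.span V) : x * a ∈ J := by
  induction hx using Submodule.span_induction with
  | mem v hv => exact h v hv
  | zero => simp
  | add u v _ _ hu hv => rw [add_mul]; exact J.add_mem hu hv
  | smul c v _ hv => rw [smul_eq_mul, mul_assoc]; exact J.mul_mem_left c hv

theorem RegularMod.noTorsionMod {V : Set R} {J : Ideal R} {x : R} (hx : RegularMod J x)
    (hxV : x ∈ Ideal.span V) : NoTorsionMod V J :=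
  fun a ha => hx a (mul_mem_of_mem_span ha hxV)

theorem NoTorsionMod.exchange {V : Set R} {J : Ideal R} {x y : R}
    (hxV : x ∈ Ideal.span V) (hx : RegularMod J x) (hy : RegularMod J y)
    (h : NoTorsionMod V (J ⊔ Ideal.span {x})) : NoTorsionMod V (J ⊔ Ideal.span {y}) := by
  intro a ha
  obtain ⟨m, hm⟩ := Ideal.mem_sup_span_singleton_iff.1 (mul_mem_of_mem_span ha hxV)
  have hmx : m ∈ J ⊔ Ideal.span {x} := by
    refine h m fun v hv => ?_
    obtain ⟨b, hb⟩ := Ideal.mem_sup_span_singleton_iff.1 (ha v hv)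
    refine Ideal.mem_sup_span_singleton_iff.2 ⟨b, hy _ ?_⟩
    convert J.sub_mem (J.mul_mem_left x hb) (J.mul_mem_left v hm) using 1
    ring
  obtain ⟨c, hc⟩ := Ideal.mem_sup_span_singleton_iff.1 hmx
  refine Ideal.mem_sup_span_singleton_iff.2 ⟨c, hx _ ?_⟩
  convert J.add_mem hm (J.mul_mem_left y hc) using 1
  ring

variable {K : Type*} [Field K] [Infinite K] [Algebra K R] [IsNoetherianRing R]

/-- Prime avoidance for a linear subspace `V`: if `V` has no torsion modulo finitely many ideals,
then some element of `V` is a non-zero-divisor modulo all of them. -/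
theorem exists_regularMod (V : Submodule K R) (S : Set (Ideal R)) (hS : S.Finite)
    (h : ∀ J ∈ S, NoTorsionMod (V : Set R) J) : ∃ w ∈ V, ∀ J ∈ S, RegularMod J w := by
  classical
  by_contra! hcon
  let T : Set (Ideal R) := ⋃ J ∈ S, associatedPrimes R (R ⧸ J)
  have hT : T.Finite := hS.biUnion fun J _ => associatedPrimes.finite R (R ⧸ J)
  let F : Finset (Submodule K V) :=
    hT.toFinset.image fun p => (p.restrictScalars K).comap V.subtype
  have hcov : ⋃ p ∈ F, (p : Set V) = Set.univ := by
    refine Set.eq_univ_of_forall fun w => ?_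
    obtain ⟨J, hJ, hw⟩ := hcon w w.2
    simp only [RegularMod, not_forall] at hw
    obtain ⟨a, ha, haJ⟩ := hw
    obtain ⟨p, hp, hle⟩ := exists_le_isAssociatedPrime_of_isNoetherianRing R
      (Ideal.Quotient.mk J a) (by rwa [Ne, Ideal.Quotient.eq_zero_iff_mem])
    simp only [Set.mem_iUnion]
    refine ⟨(p.restrictScalars K).comap V.subtype, ?_, ?_⟩
    · refine Finset.mem_image.2 ⟨p, ?_, rfl⟩
      simp only [T, Set.Finite.mem_toFinset, Set.mem_iUnion]
      exact ⟨J, hJ, hp⟩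
    · refine hle ?_
      rw [Submodule.mem_colon_singleton, Submodule.mem_bot]
      exact Ideal.Quotient.eq_zero_iff_mem.2 ha
  have htop := Subspace.top_mem_of_biUnion_eq_univ hcov
  obtain ⟨p, hp, hpt⟩ := Finset.mem_image.1 htop
  simp only [T, Set.Finite.mem_toFinset, Set.mem_iUnion] at hp
  obtain ⟨J, hJ, hpJ⟩ := hp
  obtain ⟨hprime, x, hx⟩ := isAssociatedPrime_iff.1 hpJ
  obtain ⟨a, rfl⟩ := Ideal.Quotient.mk_surjective x
  have hVp : ∀ v ∈ V, v ∈ p := fun v hv => by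
    have : (⟨v, hv⟩ : V) ∈ (p.restrictScalars K).comap V.subtype := by rw [hpt]; trivial
    exact this
  have haJ : a ∈ J := h J hJ a fun v hv => by
    have := hVp v hv
    rw [hx, Submodule.mem_colon_singleton, Submodule.mem_bot] at this
    exact Ideal.Quotient.eq_zero_iff_mem.1 this
  apply hprime.ne_top
  rw [hx, Ideal.Quotient.eq_zero_iff_mem.2 haJ]
  simp

/-- Dividing out a regular element of `I` shortens regular sequences in `I` by at most one. -/
theorem HasRegularSeq.quotient (V : Submodule K R) {r : ℕ} {J : Ideal R}
    (h : HasRegularSeq (Ideal.span (V : Set R)) (r + 1) J) {y : R}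
    (hyV : y ∈ Ideal.span (V : Set R)) (hy : RegularMod J y) :
    HasRegularSeq (Ideal.span (V : Set R)) r (J ⊔ Ideal.span {y}) := by
  induction r generalizing J y with
  | zero => trivial
  | succ r ih =>
    obtain ⟨x, hxV, hx, hseq⟩ := h
    obtain ⟨x', hx'V, hx', -⟩ := id hseq
    have hJx := hx'.noTorsionMod hx'V
    obtain ⟨w, hwV, hw⟩ := exists_regularMod V {J ⊔ Ideal.span {x}, J ⊔ Ideal.span {y}}
      (by simp) (by
        rintro _ (rfl | rfl)
        · exact hJx
        · exact hJx.exchange hxV hx hy)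
    have hwV' : w ∈ Ideal.span (V : Set R) := Ideal.subset_span hwV
    have hwx := hw (J ⊔ Ideal.span {x}) (by simp)
    have hwy := hw (J ⊔ Ideal.span {y}) (by simp)
    have hseqw : HasRegularSeq (Ideal.span (V : Set R)) (r + 1) (J ⊔ Ideal.span {w}) :=
      ⟨x, hxV, hx.swap hwx, by simpa only [sup_right_comm] using ih hseq hwV' hwx⟩
    exact ⟨w, hwV', hwy, by simpa only [sup_right_comm] using ih hseqw hyV (hy.swap hwy)⟩

end RegularSequences

section PolynomialRing

open MvPolynomial

variable {K : Type*} [Field K] {n : ℕ}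

/-- Powers of the variables form a regular sequence. -/
theorem hasRegularSeq_X_pow (I : Ideal (MvPolynomial (Fin n) K)) (N : ℕ)
    (hI : ∀ i, (X i : MvPolynomial (Fin n) K) ^ N ∈ I) : HasRegularSeq I n ⊥ := by
  let E : ℕ → Set (Fin n →₀ ℕ) := fun i => {s | ∃ j : Fin n, j.val < i ∧ s = Finsupp.single j N}
  let J : ℕ → Ideal (MvPolynomial (Fin n) K) := fun i =>
    Ideal.span ((fun s => monomial s (1 : K)) '' E i)
  suffices H : ∀ r i, i + r = n → HasRegularSeq I r (J i) by
    have h0 : J 0 = ⊥ := by simp [J, E]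
    rw [← h0]
    exact H n 0 (by simp)
  intro r
  induction r with
  | zero => intro _ _; trivial
  | succ r ih =>
    intro i hi
    let k : Fin n := ⟨i, by omega⟩
    have hX : (X k : MvPolynomial (Fin n) K) ^ N = monomial (Finsupp.single k N) 1 := by
      rw [X_pow_eq_monomial]
    refine ⟨X k ^ N, hI k, ?_, ?_⟩
    · intro a ha
      rw [hX] at ha
      refine mem_ideal_span_monomial_image.2 fun m hm => ?_
      have hm' : Finsupp.single k N + m ∈
          (monomial (Finsupp.single k N) (1 : K) * a).support := by
        rw [mem_support_iff, coeff_monomial_mul, one_mul]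
        exact mem_support_iff.1 hm
      obtain ⟨_, ⟨j, hj, rfl⟩, hle⟩ := mem_ideal_span_monomial_image.1 ha _ hm'
      refine ⟨_, ⟨j, hj, rfl⟩, ?_⟩
      have hjk : j ≠ k := fun h => by simp [h, k] at hj
      rw [Finsupp.single_le_iff] at hle ⊢
      simpa [Finsupp.single_apply, hjk.symm] using hle
    · have hJ : J i ⊔ Ideal.span {X k ^ N} = J (i + 1) := by
        have hE : E (i + 1) = E i ∪ {Finsupp.single k N} := by
          ext s
          constructor
          · rintro ⟨j, hj, rfl⟩
            rcases Nat.lt_succ_iff_lt_or_eq.1 hj with h | h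
            · exact Or.inl ⟨j, h, rfl⟩
            · have : j = k := Fin.ext h
              subst this
              exact Or.inr rfl
          · rintro (⟨j, hj, rfl⟩ | rfl)
            · exact ⟨j, hj.trans (Nat.lt_succ_self i), rfl⟩
            · exact ⟨k, Nat.lt_succ_self i, rfl⟩
        simp only [J]
        rw [hE, Set.image_union, Ideal.span_union, Set.image_singleton, hX]
      rw [hJ]
      exact ih (i + 1) (by omega)

end PolynomialRing

section LocalModel

open MvPolynomial

variable {K : Type*} [Field K] {n : ℕ} {O : Type*} [CommRing O] [Algebra K O]
  (ι : MvPolynomial (Fin n) K →ₐ[K] O)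

/-- The elements of order at least `s`: the `s`-th power of the ideal of `O` generated by the
variables. -/
def orderIdeal (s : ℕ) : Ideal O := (idealOfVars (Fin n) K ^ s).map ι

/-- `O` behaves like a local ring of functions in the variables `X i`: it has residue field `K`,
its maximal ideal is generated by the variables and nonzero forms of degree `s` have order
exactly `s`. -/
structure IsLocalModel : Prop where
  exists_const : ∀ a : O, ∃ c : K, a - algebraMap K O c ∈ orderIdeal ι 1
  eq_zero_of_mem : ∀ (s : ℕ) (A : MvPolynomial (Fin n) K), A.IsHomogeneous s →
    ι A ∈ orderIdeal ι (s + 1) → A = 0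
  le_jacobson : orderIdeal ι 1 ≤ Ideal.jacobson ⊥

variable {ι}

theorem orderIdeal_zero : orderIdeal ι 0 = ⊤ := by
  simp [orderIdeal, Ideal.one_eq_top, Ideal.map_top]

theorem orderIdeal_add (s t : ℕ) : orderIdeal ι (s + t) = orderIdeal ι s * orderIdeal ι t := by
  rw [orderIdeal, pow_add, Ideal.map_mul]; rfl

theorem orderIdeal_anti {s t : ℕ} (h : s ≤ t) : orderIdeal ι t ≤ orderIdeal ι s :=
  Ideal.map_mono (Ideal.pow_le_pow_right h)

theorem mul_mem_orderIdeal {s t r : ℕ} {a b : O} (ha : a ∈ orderIdeal ι s)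
    (hb : b ∈ orderIdeal ι t) (hr : r ≤ s + t) : a * b ∈ orderIdeal ι r :=
  orderIdeal_anti hr (orderIdeal_add (ι := ι) s t ▸ Ideal.mul_mem_mul ha hb)

theorem MvPolynomial.IsHomogeneous.mem_orderIdeal {s : ℕ} {A : MvPolynomial (Fin n) K}
    (hA : A.IsHomogeneous s) : ι A ∈ orderIdeal ι s := by
  refine Ideal.mem_map_of_mem _ ((mem_pow_idealOfVars_iff' _ _).2 fun m hm => ?_)
  exact hA.coeff_eq_zero hm.ne

/-- Every element of order at least `s` has a leading form of degree `s`. -/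
theorem IsLocalModel.exists_leadingForm (hι : IsLocalModel ι) {s : ℕ} {a : O}
    (ha : a ∈ orderIdeal ι s) :
    ∃ A : MvPolynomial (Fin n) K, A.IsHomogeneous s ∧ a - ι A ∈ orderIdeal ι (s + 1) := by
  have hspan : orderIdeal ι s = Ideal.span
      (ι '' ((fun x => monomial x (1 : K)) '' {x | x.degree = s})) := by
    rw [orderIdeal, pow_idealOfVars_eq_span, Ideal.map_span]
    rfl
  rw [hspan] at ha
  induction ha using Submodule.span_induction with
  | mem x hx =>
    obtain ⟨_, ⟨m, hm, rfl⟩, rfl⟩ := hx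
    exact ⟨monomial m 1, isHomogeneous_monomial _ hm, by simp⟩
  | zero => exact ⟨0, isHomogeneous_zero _ _ _, by simp⟩
  | add x y _ _ hx hy =>
    obtain ⟨A, hA, hxA⟩ := hx
    obtain ⟨B, hB, hyB⟩ := hy
    refine ⟨A + B, hA.add hB, ?_⟩
    convert Ideal.add_mem _ hxA hyB using 1
    rw [map_add]; ring
  | smul b x hxs hx =>
    obtain ⟨A, hA, hxA⟩ := hx
    obtain ⟨c, hc⟩ := hι.exists_const b
    have hxs' : x ∈ orderIdeal ι s := hspan ▸ hxs
    refine ⟨C c * A, by simpa using (isHomogeneous_C (Fin n) c).mul hA, ?_⟩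
    convert Ideal.add_mem _ (mul_mem_orderIdeal hc hxs' (by omega : s + 1 ≤ 1 + s))
      (Ideal.mul_mem_left _ (algebraMap K O c) hxA) using 1
    rw [map_mul, ← MvPolynomial.algebraMap_eq, AlgHom.commutes, smul_eq_mul]; ring

theorem homogeneousComponent_mem_of_span {κ : Type*} {d : ℕ}
    {h : κ → MvPolynomial (Fin n) K} {g : κ → O} (hh : ∀ i, (h i).IsHomogeneous d)
    (hg : ∀ i, g i - ι (h i) ∈ orderIdeal ι (d + 1)) {x : MvPolynomial (Fin n) K}
    (hx : x ∈ Ideal.span (Set.range h)) (c : ℕ) :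
    ι (homogeneousComponent c x) ∈ Ideal.span (Set.range g) ⊔ orderIdeal ι (c + 1) := by
  induction hx using Submodule.span_induction generalizing c with
  | mem x hx =>
    obtain ⟨i, rfl⟩ := hx
    rw [homogeneousComponent_of_mem (hh i)]
    split_ifs with hcd
    · subst hcd
      convert Ideal.sub_mem _ (Ideal.mem_sup_left (Ideal.subset_span (Set.mem_range_self i)))
        (Ideal.mem_sup_right (hg i)) using 1
      ring
    · simp
  | zero => simp
  | add x y _ _ hx hy =>
    rw [map_add, map_add]
    exact Ideal.add_mem _ (hx c) (hy c)
  | smul b x _ hx =>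
    rw [smul_eq_mul, ← sum_homogeneousComponent b, ← sum_homogeneousComponent x,
      Finset.sum_mul_sum, map_sum, map_sum]
    refine Ideal.sum_mem _ fun i _ => ?_
    rw [map_sum, map_sum]
    refine Ideal.sum_mem _ fun j _ => ?_
    have hb : (homogeneousComponent i b).IsHomogeneous i := homogeneousComponent_isHomogeneous _ _
    rw [homogeneousComponent_of_mem (hb.mul (homogeneousComponent_isHomogeneous j x))]
    split_ifs with hc
    · subst hc
      obtain ⟨u, hu, v, hv, huv⟩ := Submodule.mem_sup.1 (hx j)
      rw [map_mul, ← huv, mul_add]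
      exact Ideal.add_mem _ (Ideal.mem_sup_left (Ideal.mul_mem_left _ _ hu))
        (Ideal.mem_sup_right (mul_mem_orderIdeal (IsHomogeneous.mem_orderIdeal hb) hv
          (by omega)))
    · simp

variable (ι) in
/-- The leading forms of the elements of `G` belong to `H`. -/
def LeadingFormsIn (H : Ideal (MvPolynomial (Fin n) K)) (G : Ideal O) : Prop :=
  ∀ (c : ℕ) (A : MvPolynomial (Fin n) K), A.IsHomogeneous c →
    ι A ∈ G ⊔ orderIdeal ι (c + 1) → A ∈ H

theorem LeadingFormsIn.sup_span_singleton (hι : IsLocalModel ι)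
    {H : Ideal (MvPolynomial (Fin n) K)} {G : Ideal O} (hL : LeadingFormsIn ι H G)
    (hU : ∀ x ∈ H, ∀ c, ι (homogeneousComponent c x) ∈ G ⊔ orderIdeal ι (c + 1))
    {d : ℕ} {h : MvPolynomial (Fin n) K} {g : O} (hh : h.IsHomogeneous d)
    (hg : g - ι h ∈ orderIdeal ι (d + 1)) (hreg : RegularMod H h) :
    LeadingFormsIn ι (H ⊔ Ideal.span {h}) (G ⊔ Ideal.span {g}) := by
  intro c A hA hAG
  have hhd : ι h ∈ orderIdeal ι d := IsHomogeneous.mem_orderIdeal hh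
  have hgd : g ∈ orderIdeal ι d := by
    convert Ideal.add_mem _ hhd (orderIdeal_anti (Nat.le_succ d) hg) using 1
    ring
  rw [sup_right_comm] at hAG
  have key : ∀ e, e + d ≤ c ∨ e = 0 →
      ∃ a ∈ orderIdeal ι e, ι A - a * g ∈ G ⊔ orderIdeal ι (c + 1) := by
    intro e
    induction e with
    | zero =>
      intro _
      obtain ⟨a, ha⟩ := Ideal.mem_sup_span_singleton_iff.1 hAG
      exact ⟨a, by simp [orderIdeal_zero], ha⟩
    | succ e ih =>
      intro he
      have he : e + 1 + d ≤ c := he.resolve_right (by omega)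
      obtain ⟨a, ha, haA⟩ := ih (Or.inl (by omega))
      obtain ⟨B, hB, haB⟩ := hι.exists_leadingForm ha
      have hle : G ⊔ orderIdeal ι (c + 1) ≤ G ⊔ orderIdeal ι (e + d + 1) :=
        sup_le_sup_left (orderIdeal_anti (by omega)) _
      have hBh : ι (B * h) ∈ G ⊔ orderIdeal ι (e + d + 1) := by
        have h1 : (a - ι B) * ι h ∈ orderIdeal ι (e + d + 1) :=
          mul_mem_orderIdeal haB hhd (by omega)
        have h2 : a * (g - ι h) ∈ orderIdeal ι (e + d + 1) :=
          mul_mem_orderIdeal ha hg (by omega)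
        have h3 : ι A ∈ orderIdeal ι (e + d + 1) :=
          orderIdeal_anti (by omega) (IsHomogeneous.mem_orderIdeal hA)
        convert Ideal.sub_mem _ (Ideal.mem_sup_right
          (Ideal.sub_mem _ (Ideal.sub_mem _ h3 h1) h2)) (hle haA) using 1
        rw [map_mul]; ring
      have hBH : B ∈ H := hreg B (by
        rw [mul_comm]
        exact hL _ _ (hB.mul hh) hBh)
      have hBU := hU B hBH e
      rw [homogeneousComponent_of_mem hB, if_pos rfl] at hBU
      obtain ⟨u, hu, v, hv, huv⟩ := Submodule.mem_sup.1 hBU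
      refine ⟨v + (a - ι B), Ideal.add_mem _ hv haB, ?_⟩
      convert Ideal.add_mem _ haA (Ideal.mem_sup_left (Ideal.mul_mem_left _ g hu)) using 1
      rw [← huv]; ring
  rcases le_or_gt d c with hdc | hcd
  · obtain ⟨a, ha, haA⟩ := key (c - d) (Or.inl (by omega))
    obtain ⟨B, hB, haB⟩ := hι.exists_leadingForm ha
    have hBh : (B * h).IsHomogeneous c := by
      have := hB.mul hh
      rwa [Nat.sub_add_cancel hdc] at this
    refine Ideal.mem_sup_span_singleton_iff.2 ⟨B, hL c _ (hA.sub hBh) ?_⟩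
    have h1 : (a - ι B) * ι h ∈ orderIdeal ι (c + 1) :=
      mul_mem_orderIdeal haB hhd (by omega)
    have h2 : a * (g - ι h) ∈ orderIdeal ι (c + 1) :=
      mul_mem_orderIdeal ha hg (by omega)
    convert Ideal.add_mem _ haA (Ideal.mem_sup_right (Ideal.add_mem _ h1 h2)) using 1
    rw [map_sub, map_mul]; ring
  · obtain ⟨a, -, haA⟩ := key 0 (Or.inr rfl)
    refine Ideal.mem_sup_left (hL c A hA ?_)
    have h1 : a * g ∈ orderIdeal ι (c + 1) :=
      Ideal.mul_mem_left _ _ (orderIdeal_anti (by omega) hgd)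
    convert Ideal.add_mem _ haA (Ideal.mem_sup_right h1) using 1
    ring

end LocalModel

section LeadingForms

open MvPolynomial Module

theorem Ideal.span_image_sup_span_singleton {K E B : Type*} [Field K] [AddCommGroup E]
    [Module K E] [CommRing B] [Algebra K B] (ψ : E →ₗ[K] B) (U : Submodule K E) (v : E) :
    Ideal.span (Set.range fun u : ↥(U ⊔ Submodule.span K {v}) => ψ u) =
      Ideal.span (Set.range fun u : U => ψ u) ⊔ Ideal.span {ψ v} := by
  apply le_antisymm
  · rw [Ideal.span_le]
    rintro _ ⟨⟨u, hu⟩, rfl⟩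
    obtain ⟨u', hu', w, hw, rfl⟩ := Submodule.mem_sup.1 hu
    obtain ⟨c, rfl⟩ := Submodule.mem_span_singleton.1 hw
    simp only [map_add, map_smul]
    refine Ideal.add_mem _ (Ideal.mem_sup_left (Ideal.subset_span ⟨⟨u', hu'⟩, rfl⟩))
      (Ideal.mem_sup_right ?_)
    rw [Algebra.smul_def]
    exact Ideal.mul_mem_left _ _ (Ideal.mem_span_singleton_self _)
  · refine sup_le (Ideal.span_mono ?_) ?_
    · rintro _ ⟨⟨u, hu⟩, rfl⟩
      exact ⟨⟨u, Submodule.mem_sup_left hu⟩, rfl⟩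
    · rw [Ideal.span_singleton_le_iff_mem]
      exact Ideal.subset_span
        ⟨⟨v, Submodule.mem_sup_right (Submodule.mem_span_singleton_self v)⟩, rfl⟩

theorem Ideal.span_range_linearCombination {K B κ : Type*} [Field K] [Fintype κ] [CommRing B]
    [Algebra K B] (h : κ → B) :
    Ideal.span (Set.range fun u : (⊤ : Submodule K (κ → K)) =>
      Fintype.linearCombination K h u) = Ideal.span (Set.range h) := by
  classical
  apply le_antisymm <;> rw [Ideal.span_le]
  · rintro _ ⟨⟨u, -⟩, rfl⟩
    simp only [Fintype.linearCombination_apply]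
    refine Ideal.sum_mem _ fun i _ => ?_
    rw [Algebra.smul_def]
    exact Ideal.mul_mem_left _ _ (Ideal.subset_span ⟨i, rfl⟩)
  · rintro _ ⟨i, rfl⟩
    exact Ideal.subset_span ⟨⟨Pi.single i 1, trivial⟩, by simp⟩

variable {K : Type*} [Field K] {n : ℕ} {O : Type*} [CommRing O] [Algebra K O]
  {ι : MvPolynomial (Fin n) K →ₐ[K] O}

theorem MvPolynomial.IsHomogeneous.linearCombination {κ : Type*} [Fintype κ] {d : ℕ}
    {h : κ → MvPolynomial (Fin n) K} (hh : ∀ i, (h i).IsHomogeneous d) (u : κ → K) :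
    (Fintype.linearCombination K h u).IsHomogeneous d := by
  rw [Fintype.linearCombination_apply, ← mem_homogeneousSubmodule]
  exact Submodule.sum_mem _ fun i _ => Submodule.smul_mem _ _ (hh i)

theorem linearCombination_sub_mem_orderIdeal {κ : Type*} [Fintype κ] {d : ℕ}
    {h : κ → MvPolynomial (Fin n) K} {g : κ → O}
    (hg : ∀ i, g i - ι (h i) ∈ orderIdeal ι (d + 1)) (u : κ → K) :
    Fintype.linearCombination K g u - ι (Fintype.linearCombination K h u) ∈
      orderIdeal ι (d + 1) := by
  simp only [Fintype.linearCombination_apply, map_sum, map_smul, ← Finset.sum_sub_distrib,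
    ← smul_sub]
  refine Ideal.sum_mem _ fun i _ => ?_
  rw [Algebra.smul_def]
  exact Ideal.mul_mem_left _ _ (hg i)

/-- If forms `h i`, as many as there are variables, have no common zero outside the origin, then
the leading forms of the ideal generated by perturbations `g i` of higher order lie in the ideal
generated by the `h i`. -/
theorem leadingFormsIn_span [Infinite K] (hι : IsLocalModel ι) {d N : ℕ}
    {h : Fin n → MvPolynomial (Fin n) K} {g : Fin n → O} (hh : ∀ i, (h i).IsHomogeneous d)
    (hg : ∀ i, g i - ι (h i) ∈ orderIdeal ι (d + 1))
    (hN : ∀ i, (X i : MvPolynomial (Fin n) K) ^ N ∈ Ideal.span (Set.range h)) :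
    LeadingFormsIn ι (Ideal.span (Set.range h)) (Ideal.span (Set.range g)) := by
  by_cases htop : Ideal.span (Set.range h) = ⊤
  · intro c A _ _
    rw [htop]; trivial
  let φ := Fintype.linearCombination K h
  let γ := Fintype.linearCombination K g
  let V : Submodule K (MvPolynomial (Fin n) K) := LinearMap.range φ
  have hV : Ideal.span (V : Set (MvPolynomial (Fin n) K)) = Ideal.span (Set.range h) := by
    rw [← Ideal.span_range_linearCombination (K := K) h]
    congr 1
    ext x
    constructor
    · rintro ⟨u, rfl⟩
      exact ⟨⟨u, trivial⟩, rfl⟩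
    · rintro ⟨u, rfl⟩
      exact ⟨u, rfl⟩
  let J : Submodule K (Fin n → K) → Ideal (MvPolynomial (Fin n) K) := fun U =>
    Ideal.span (Set.range fun u : U => φ u)
  let G : Submodule K (Fin n → K) → Ideal O := fun U => Ideal.span (Set.range fun u : U => γ u)
  have hJ : ∀ U, J U ≤ Ideal.span (V : Set (MvPolynomial (Fin n) K)) := fun U => by
    refine Ideal.span_mono ?_
    rintro _ ⟨u, rfl⟩
    exact ⟨u, rfl⟩
  have key : ∀ r ≤ n, ∃ U : Submodule K (Fin n → K), finrank K U = r ∧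
      LeadingFormsIn ι (J U) (G U) ∧ HasRegularSeq (Ideal.span V) (n - r) (J U) := by
    intro r
    induction r with
    | zero =>
      intro _
      have h1 : J ⊥ = ⊥ := by
        rw [eq_bot_iff, Ideal.span_le]
        rintro _ ⟨⟨u, hu⟩, rfl⟩
        rw [Submodule.mem_bot] at hu
        simp [hu]
      have h2 : G ⊥ = ⊥ := by
        rw [eq_bot_iff, Ideal.span_le]
        rintro _ ⟨⟨u, hu⟩, rfl⟩
        rw [Submodule.mem_bot] at hu
        simp [hu]
      refine ⟨⊥, finrank_bot _ _, ?_, ?_⟩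
      · rw [h1, h2]
        intro c A hA hAc
        rw [bot_sup_eq] at hAc
        rw [hι.eq_zero_of_mem c A hA hAc]
        exact Submodule.zero_mem _
      · rw [h1, hV]
        exact hasRegularSeq_X_pow _ N hN
    | succ r ih =>
      intro hr
      obtain ⟨U, hUr, hL, hseq⟩ := ih (by omega)
      obtain ⟨q, hq⟩ : ∃ q, n - r = q + 1 := ⟨n - (r + 1), by omega⟩
      rw [hq] at hseq
      obtain ⟨x, hxV, hx, -⟩ := id hseq
      obtain ⟨w, ⟨v, rfl⟩, hw⟩ := exists_regularMod V {J U} (Set.finite_singleton _) (by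
        rintro _ rfl
        exact hx.noTorsionMod hxV)
      have hw := hw _ rfl
      have hv : v ∉ U := fun hv => by
        apply htop
        rw [← hV, Ideal.eq_top_iff_one]
        exact hJ U (hw 1 (by
          rw [mul_one]
          exact Ideal.subset_span ⟨⟨v, hv⟩, rfl⟩))
      have hJ' : J (U ⊔ Submodule.span K {v}) = J U ⊔ Ideal.span {φ v} :=
        Ideal.span_image_sup_span_singleton φ U v
      have hG' : G (U ⊔ Submodule.span K {v}) = G U ⊔ Ideal.span {γ v} :=
        Ideal.span_image_sup_span_singleton γ U v
      refine ⟨U ⊔ Submodule.span K {v},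
        by rw [Submodule.finrank_sup_span_singleton hv, hUr], ?_, ?_⟩
      · rw [hJ', hG']
        exact hL.sup_span_singleton hι
          (fun x hx c => homogeneousComponent_mem_of_span
            (fun u : U => IsHomogeneous.linearCombination hh u)
            (fun u : U => linearCombination_sub_mem_orderIdeal hg u) hx c)
          (IsHomogeneous.linearCombination hh v) (linearCombination_sub_mem_orderIdeal hg v) hw
      · rw [hJ', show n - (r + 1) = q by omega]
        exact hseq.quotient V (Ideal.subset_span ⟨v, rfl⟩) hw
  obtain ⟨U, hU, hL, -⟩ := key n le_rfl
  have hUtop : U = ⊤ := Submodule.eq_top_of_finrank_eq (by rw [hU]; simp)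
  subst hUtop
  simpa only [J, G, φ, γ, Ideal.span_range_linearCombination] using hL

/-- In each degree the forms have a linear complement of the forms in `H`; the sum of these
complements is a complement of `H` adapted to the grading. -/
theorem exists_gradedComplement (H : Ideal (MvPolynomial (Fin n) K)) :
    ∃ W : Submodule K (MvPolynomial (Fin n) K),
      (∀ x ∈ W, ∀ s, homogeneousComponent s x ∈ W) ∧
      (∀ x ∈ W, ∀ s, x.IsHomogeneous s → x ∈ H → x = 0) ∧
      ∀ (s : ℕ) (A : MvPolynomial (Fin n) K), A.IsHomogeneous s →
        ∃ w ∈ W, w.IsHomogeneous s ∧ A - w ∈ H := by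
  have hex : ∀ s, ∃ c, Disjoint (H.restrictScalars K ⊓ homogeneousSubmodule (Fin n) K s) c ∧
      (H.restrictScalars K ⊓ homogeneousSubmodule (Fin n) K s) ⊔ c =
        homogeneousSubmodule (Fin n) K s := fun s =>
    IsModularLattice.exists_disjoint_and_sup_eq inf_le_right
  choose C hdisj hsup using hex
  have hC : ∀ s, C s ≤ homogeneousSubmodule (Fin n) K s := fun s => hsup s ▸ le_sup_right
  have hcomp : ∀ {s x}, x ∈ C s → ∀ i, homogeneousComponent i x ∈ C i := fun {s x} hx i => by
    rw [homogeneousComponent_of_mem (hC s hx)]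
    split_ifs with h
    · exact h ▸ hx
    · exact zero_mem _
  refine ⟨⨅ s, (C s).comap (homogeneousComponent s), ?_, ?_, ?_⟩
  · intro x hx s
    rw [Submodule.mem_iInf] at hx ⊢
    exact hcomp (hx s)
  · intro x hx s hxs hxH
    have := (Submodule.mem_iInf _).1 hx s
    rw [Submodule.mem_comap, homogeneousComponent_of_mem hxs, if_pos rfl] at this
    exact Submodule.disjoint_def.1 (hdisj s) x ⟨hxH, hxs⟩ this
  · intro s A hA
    rw [← mem_homogeneousSubmodule, ← hsup s] at hA
    obtain ⟨u, hu, w, hw, rfl⟩ := Submodule.mem_sup.1 hA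
    exact ⟨w, (Submodule.mem_iInf _).2 (hcomp hw), hC s hw, by simpa using hu.1⟩

theorem sub_homogeneousComponent_mem_pow {x : MvPolynomial (Fin n) K} {s : ℕ}
    (hx : ∀ i < s, homogeneousComponent i x = 0) :
    x - homogeneousComponent s x ∈ idealOfVars (Fin n) K ^ (s + 1) := by
  refine (mem_pow_idealOfVars_iff' _ _).2 fun m hm => ?_
  rw [coeff_sub, coeff_homogeneousComponent]
  split_ifs with h
  · exact sub_self _
  · have := congrArg (coeff m) (hx m.degree (by omega))
    rw [coeff_homogeneousComponent, if_pos rfl, coeff_zero] at this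
    rw [this, sub_zero]

/-- The dimension of the quotient of `O` by perturbations of higher order of `n` forms without
common zero outside the origin depends only on these forms. -/
theorem finrank_quotient_eq_of_leadingForms [Infinite K] (hι : IsLocalModel ι) {d : ℕ}
    {h : Fin n → MvPolynomial (Fin n) K} {g g' : Fin n → O} (hh : ∀ i, (h i).IsHomogeneous d)
    (hg : ∀ i, g i - ι (h i) ∈ orderIdeal ι (d + 1))
    (hg' : ∀ i, g' i - ι (h i) ∈ orderIdeal ι (d + 1))
    (hrad : ∀ i, (X i : MvPolynomial (Fin n) K) ∈ (Ideal.span (Set.range h)).radical) :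
    finrank K (O ⧸ Ideal.span (Set.range g)) = finrank K (O ⧸ Ideal.span (Set.range g')) := by
  set H := Ideal.span (Set.range h) with hH
  obtain ⟨W, hWcomp, hWH, hWex⟩ := exists_gradedComplement H
  obtain ⟨N, hN⟩ : ∃ N, idealOfVars (Fin n) K ^ N ≤ H :=
    Ideal.exists_pow_le_of_le_radical_of_fg
      (by rw [Ideal.span_le]; rintro _ ⟨i, rfl⟩; exact hrad i) (idealOfVars_fg _ _)
  suffices key : ∀ g : Fin n → O, (∀ i, g i - ι (h i) ∈ orderIdeal ι (d + 1)) →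
      finrank K W = finrank K (O ⧸ Ideal.span (Set.range g)) from
    (key g hg).symm.trans (key g' hg')
  intro g hg
  set G := Ideal.span (Set.range g) with hG
  have hL : LeadingFormsIn ι H G := leadingFormsIn_span hι hh hg (N := N) fun i =>
    hN (Ideal.pow_mem_pow (Ideal.subset_span (Set.mem_range_self i)) N)
  have hU : ∀ (s : ℕ) (A : MvPolynomial (Fin n) K), A.IsHomogeneous s → A ∈ H →
      ι A ∈ G ⊔ orderIdeal ι (s + 1) := fun s A hA hAH => by
    have := homogeneousComponent_mem_of_span hh hg hAH s
    rwa [homogeneousComponent_of_mem hA, if_pos rfl] at this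
  have hNG : orderIdeal ι N ≤ G := by
    refine Submodule.le_of_le_smul_of_le_jacobson_bot (I := orderIdeal ι 1) ?_ hι.le_jacobson ?_
    · exact Ideal.FG.map (Ideal.FG.pow (idealOfVars_fg _ _)) _
    · rw [smul_eq_mul, ← orderIdeal_add, add_comm 1 N]
      nth_rw 1 [orderIdeal]
      rw [pow_idealOfVars_eq_span, Ideal.map_span, Ideal.span_le]
      rintro _ ⟨_, ⟨m, hm, rfl⟩, rfl⟩
      refine hU N _ (isHomogeneous_monomial _ hm) (hN ?_)
      rw [pow_idealOfVars_eq_span]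
      exact Ideal.subset_span ⟨m, hm, rfl⟩
  let π : W →ₗ[K] O ⧸ G :=
    (Ideal.Quotient.mkₐ K G).toLinearMap ∘ₗ ι.toLinearMap ∘ₗ W.subtype
  have hπ : ∀ x : W, π x = Ideal.Quotient.mk G (ι x) := fun _ => rfl
  refine (LinearEquiv.ofBijective π ⟨?_, ?_⟩).finrank_eq
  · rw [← LinearMap.ker_eq_bot, eq_bot_iff]
    rintro ⟨x, hx⟩ hxG
    rw [LinearMap.mem_ker, hπ, Ideal.Quotient.eq_zero_iff_mem] at hxG
    have hzero : ∀ s, homogeneousComponent s x = 0 := by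
      intro s
      induction s using Nat.strong_induction_on with
      | _ s ih =>
        have hs := homogeneousComponent_isHomogeneous s x
        refine hWH _ (hWcomp x hx s) s hs (hL s _ hs ?_)
        have : ι (x - homogeneousComponent s x) ∈ orderIdeal ι (s + 1) :=
          Ideal.mem_map_of_mem ι (sub_homogeneousComponent_mem_pow ih)
        convert Ideal.sub_mem _ (Ideal.mem_sup_left hxG) (Ideal.mem_sup_right this) using 1
        rw [map_sub]; ring
    have hx0 : x = 0 := by
      rw [← sum_homogeneousComponent x]
      exact Finset.sum_eq_zero fun i _ => hzero i
    simp [hx0]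
  · have hsurj : ∀ s (a : O), ∃ x ∈ W, a - ι x ∈ G ⊔ orderIdeal ι s := by
      intro s a
      induction s with
      | zero => exact ⟨0, zero_mem _, by simp [orderIdeal_zero]⟩
      | succ s ih =>
        obtain ⟨x, hx, hax⟩ := ih
        obtain ⟨u, hu, v, hv, huv⟩ := Submodule.mem_sup.1 hax
        obtain ⟨A, hA, hvA⟩ := hι.exists_leadingForm hv
        obtain ⟨w, hw, hws, hAw⟩ := hWex s A hA
        refine ⟨x + w, add_mem hx hw, ?_⟩
        convert Ideal.add_mem _ (Ideal.add_mem _ (Ideal.mem_sup_left hu)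
          (Ideal.mem_sup_right hvA)) (hU s _ (hA.sub hws) hAw) using 1
        rw [map_add, map_sub, ← sub_sub, ← huv]; ring
    intro y
    obtain ⟨a, rfl⟩ := Ideal.Quotient.mk_surjective y
    obtain ⟨x, hx, hax⟩ := hsurj N a
    rw [sup_eq_left.2 hNG] at hax
    refine ⟨⟨x, hx⟩, ?_⟩
    rw [hπ, eq_comm, Ideal.Quotient.eq]
    exact hax

end LeadingForms

section AnalyticGerms

open MvPolynomial Asymptotics

variable {n : ℕ}

/-- The germ at `0` of a function which is analytic at `0`. -/
def germOf (F : En n → ℂ) (hF : AnalyticAt ℂ F 0) : AnalyticGerms n := ⟨F, F, hF, rfl⟩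

theorem germOf_eq_iff {F G : En n → ℂ} {hF : AnalyticAt ℂ F 0} {hG : AnalyticAt ℂ G 0} :
    germOf F hF = germOf G hG ↔ F =ᶠ[𝓝 0] G := by
  rw [← Filter.Germ.coe_eq]
  exact Subtype.ext_iff

theorem exists_germOf (a : AnalyticGerms n) : ∃ F hF, a = germOf F hF := by
  obtain ⟨_, F, hF, rfl⟩ := a
  exact ⟨F, hF, rfl⟩

theorem germOf_add {F G : En n → ℂ} (hF : AnalyticAt ℂ F 0) (hG : AnalyticAt ℂ G 0) :
    germOf F hF + germOf G hG = germOf (F + G) (hF.add hG) := rfl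

theorem germOf_sub {F G : En n → ℂ} (hF : AnalyticAt ℂ F 0) (hG : AnalyticAt ℂ G 0) :
    germOf F hF - germOf G hG = germOf (F - G) (hF.sub hG) := rfl

theorem germOf_mul {F G : En n → ℂ} (hF : AnalyticAt ℂ F 0) (hG : AnalyticAt ℂ G 0) :
    germOf F hF * germOf G hG = germOf (F * G) (hF.mul hG) := rfl

theorem germOf_sum {κ : Type*} (s : Finset κ) {F : κ → En n → ℂ}
    (hF : ∀ i, AnalyticAt ℂ (F i) 0) : ∑ i ∈ s, germOf (F i) (hF i) =
      germOf (∑ i ∈ s, F i) (s.analyticAt_sum fun i _ => hF i) := by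
  classical
  induction s using Finset.induction_on with
  | empty => simp only [Finset.sum_empty]; rfl
  | insert i s hi ih => simp only [Finset.sum_insert hi, ih, germOf_add]

theorem algebraMap_eq_germOf (c : ℂ) :
    algebraMap ℂ (AnalyticGerms n) c = germOf (fun _ => c) analyticAt_const := rfl

theorem analyticAt_coord (i : Fin n) (z : En n) : AnalyticAt ℂ (fun z : En n => z i) z :=
  (EuclideanSpace.proj (𝕜 := ℂ) i).analyticAt z

/-- The germs of polynomial functions. -/
def polyGerm (n : ℕ) : MvPolynomial (Fin n) ℂ →ₐ[ℂ] AnalyticGerms n :=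
  aeval fun i => germOf (fun z => z i) (analyticAt_coord i 0)

theorem evalE_C (c : ℂ) : evalE (n := n) (C c) = fun _ => c := by
  ext z
  simp [evalE]

theorem evalE_add (A B : MvPolynomial (Fin n) ℂ) : evalE (A + B) = evalE A + evalE B := by
  ext z
  simp [evalE]

theorem evalE_mul_X (A : MvPolynomial (Fin n) ℂ) (i : Fin n) :
    evalE (A * X i) = evalE A * fun z => z i := by
  ext z
  simp [evalE]

theorem evalE_zero : evalE (0 : MvPolynomial (Fin n) ℂ) = 0 := by
  ext z
  simp [evalE]

theorem analyticAt_evalE (A : MvPolynomial (Fin n) ℂ) (z : En n) : AnalyticAt ℂ (evalE A) z := by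
  induction A using MvPolynomial.induction_on with
  | C c => rw [evalE_C]; exact analyticAt_const
  | add p q hp hq => rw [evalE_add]; exact hp.add hq
  | mul_X p i hp => rw [evalE_mul_X]; exact hp.mul (analyticAt_coord i z)

theorem polyGerm_apply (A : MvPolynomial (Fin n) ℂ) :
    polyGerm n A = germOf (evalE A) (analyticAt_evalE A 0) := by
  induction A using MvPolynomial.induction_on with
  | C c =>
    rw [polyGerm, ← MvPolynomial.algebraMap_eq, AlgHom.commutes, algebraMap_eq_germOf,
      germOf_eq_iff, MvPolynomial.algebraMap_eq, evalE_C]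
  | add p q hp hq =>
    rw [map_add, hp, hq, germOf_add, germOf_eq_iff, evalE_add]
  | mul_X p i hp =>
    rw [map_mul, hp, polyGerm, aeval_X, germOf_mul, germOf_eq_iff, evalE_mul_X]

theorem orderIdeal_one_eq_span : orderIdeal (polyGerm n) 1 =
    Ideal.span (Set.range fun i => germOf (fun z => z i) (analyticAt_coord i 0)) := by
  rw [orderIdeal, pow_one, idealOfVars, Ideal.map_span, ← Set.range_comp]
  congr 2
  ext1 i
  simp [polyGerm]

/-- The ideal of analytic germs which are `O(‖z‖ ^ s)`. -/
def bigOIdeal (n s : ℕ) : Ideal (AnalyticGerms n) where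
  carrier := {a | ∃ F hF, a = germOf F hF ∧ F =O[𝓝 0] fun z => ‖z‖ ^ s}
  add_mem' := by
    rintro _ _ ⟨F, hF, rfl, h⟩ ⟨G, hG, rfl, h'⟩
    exact ⟨F + G, hF.add hG, rfl, h.add h'⟩
  zero_mem' := ⟨0, analyticAt_const, rfl, isBigO_zero _ _⟩
  smul_mem' := by
    rintro c _ ⟨F, hF, rfl, h⟩
    obtain ⟨G, hG, rfl⟩ := exists_germOf c
    refine ⟨G * F, hG.mul hF, rfl, ?_⟩
    simpa using! (hG.continuousAt.isBigO_one ℝ).mul h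

theorem germOf_mem_bigOIdeal {F : En n → ℂ} {hF : AnalyticAt ℂ F 0} {s : ℕ} :
    germOf F hF ∈ bigOIdeal n s ↔ F =O[𝓝 0] fun z => ‖z‖ ^ s :=
  ⟨fun ⟨_, _, h, hG⟩ => (germOf_eq_iff.1 h).trans_isBigO hG, fun h => ⟨F, hF, rfl, h⟩⟩

theorem orderIdeal_le_bigOIdeal (s : ℕ) : orderIdeal (polyGerm n) s ≤ bigOIdeal n s := by
  induction s with
  | zero =>
    intro a _
    obtain ⟨F, hF, rfl⟩ := exists_germOf a
    rw [germOf_mem_bigOIdeal]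
    simpa using (hF.continuousAt.isBigO_one ℝ)
  | succ s ih =>
    rw [orderIdeal_add, Ideal.mul_le]
    intro a ha b hb
    have hb' : b ∈ bigOIdeal n 1 := by
      refine (Ideal.span_le.2 ?_ : Ideal.span _ ≤ _) (orderIdeal_one_eq_span (n := n) ▸ hb)
      rintro _ ⟨i, rfl⟩
      refine germOf_mem_bigOIdeal.2 (IsBigO.of_norm_le fun z => ?_)
      simpa using PiLp.norm_apply_le z i
    obtain ⟨F, hF, rfl, h⟩ := ih ha
    obtain ⟨G, hG, rfl, h'⟩ := hb'
    refine ⟨F * G, hF.mul hG, rfl, ?_⟩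
    simpa [pow_succ] using! h.mul h'

theorem isBigO_norm_pow_of_le {E : Type*} [SeminormedAddCommGroup E] {s t : ℕ} (h : s ≤ t) :
    (fun z : E => ‖z‖ ^ t) =O[𝓝 0] fun z => ‖z‖ ^ s := by
  refine IsBigO.of_bound 1 ?_
  filter_upwards [Metric.ball_mem_nhds (0 : E) one_pos] with z hz
  rw [mem_ball_zero_iff] at hz
  simpa using pow_le_pow_of_le_one (norm_nonneg z) hz.le h

/-- A homogeneous function of degree `s` which is `O(‖z‖ ^ (s + 1))` vanishes. -/
theorem eq_zero_of_homogeneous_of_isBigO {E : Type*} [NormedAddCommGroup E] [NormedSpace ℂ E]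
    {Q : E → ℂ} {s : ℕ} (hQ : ∀ (c : ℂ) z, Q (c • z) = c ^ s * Q z)
    (hO : Q =O[𝓝 0] fun z => ‖z‖ ^ (s + 1)) : Q = 0 := by
  funext z
  have hlim : Filter.Tendsto (fun c : ℂ => c • z) (𝓝[≠] 0) (𝓝 0) := by
    have : Filter.Tendsto (fun c : ℂ => c • z) (𝓝 0) (𝓝 ((0 : ℂ) • z)) :=
      (continuous_id.smul continuous_const).tendsto 0
    rw [zero_smul] at this
    exact this.mono_left nhdsWithin_le_nhds
  have h1 : (fun _ : ℂ => Q z) =O[𝓝[≠] 0] fun c => c := by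
    have h2 : (fun c : ℂ => (c ^ s)⁻¹ * Q (c • z)) =O[𝓝[≠] 0]
        fun c => (c ^ s)⁻¹ * ((‖c • z‖ ^ (s + 1) : ℝ) : ℂ) :=
      (isBigO_refl _ _).mul ((hO.comp_tendsto hlim).trans
        (IsBigO.of_bound 1 (.of_forall fun c => by simp)))
    have h3 : (fun c : ℂ => (c ^ s)⁻¹ * ((‖c • z‖ ^ (s + 1) : ℝ) : ℂ)) =O[𝓝[≠] 0] fun c => c := by
      refine IsBigO.of_bound (‖z‖ ^ (s + 1)) ?_
      filter_upwards [self_mem_nhdsWithin] with c hc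
      have hc' : ‖c‖ ≠ 0 := norm_ne_zero_iff.2 hc
      simp only [norm_mul, norm_inv, norm_pow, norm_smul, Complex.norm_real, norm_norm]
      apply le_of_eq
      field_simp
      ring
    refine (h2.trans h3).congr' ?_ .rfl
    filter_upwards [self_mem_nhdsWithin] with c hc
    rw [hQ, inv_mul_cancel_left₀ (pow_ne_zero _ hc)]
  have h2 : Filter.Tendsto (fun _ : ℂ => Q z) (𝓝[≠] 0) (𝓝 0) :=
    h1.trans_tendsto (Filter.tendsto_id.mono_left nhdsWithin_le_nhds)
  exact tendsto_nhds_unique tendsto_const_nhds h2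

theorem MvPolynomial.IsHomogeneous.evalE_smul {A : MvPolynomial (Fin n) ℂ} {s : ℕ}
    (hA : A.IsHomogeneous s) (c : ℂ) (z : En n) : evalE A (c • z) = c ^ s * evalE A z := by
  simp only [evalE]
  rw [eval_eq, eval_eq, Finset.mul_sum]
  refine Finset.sum_congr rfl fun m hm => ?_
  have hdeg : ∑ i ∈ m.support, m i = s := (hA.degree_eq_sum_deg_support hm).symm
  simp only [PiLp.smul_apply, smul_eq_mul, mul_pow, Finset.prod_mul_distrib,
    Finset.prod_pow_eq_pow_sum, hdeg]
  ring

theorem evalE_injective : Function.Injective (evalE (n := n)) := fun _ _ h =>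
  MvPolynomial.funext fun x => congrFun h (WithLp.toLp 2 x)

/-- Hadamard's lemma. -/
theorem germOf_sub_const_mem {F : En n → ℂ} (hF : AnalyticAt ℂ F 0) :
    germOf F hF - algebraMap ℂ _ (F 0) ∈ orderIdeal (polyGerm n) 1 := by
  obtain ⟨p, r, hp⟩ := id hF
  have hr : 0 < p.shift.radius := by
    rw [FormalMultilinearSeries.radius_shift]
    exact hp.r_pos.trans_le hp.r_le
  have hL := p.shift.hasFPowerSeriesOnBall hr
  have hF' : F =ᶠ[𝓝 0] fun z => F 0 + p.shift.sum z z := by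
    have h1 := (hL.unshift (z := F 0)).hasFPowerSeriesAt
    have h2 : p.shift.unshift (F 0) = p := by
      ext1 k
      cases k with
      | zero =>
        ext v
        simp [FormalMultilinearSeries.unshift, ← hp.coeff_zero v]
      | succ k =>
        exact LinearIsometryEquiv.symm_apply_apply (continuousMultilinearCurryRightEquiv' ℂ k _ _) _
    rw [h2] at h1
    simpa [Filter.EventuallyEq] using hp.hasFPowerSeriesAt.eventually_hasSum.mp
      (h1.eventually_hasSum.mono fun z h h' => h'.unique h)
  have hc : ∀ i : Fin n, AnalyticAt ℂ
      (fun z => p.shift.sum z (EuclideanSpace.single i (1 : ℂ))) 0 := fun i =>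
    ((ContinuousLinearMap.apply ℂ ℂ (EuclideanSpace.single i (1 : ℂ) : En n)).analyticAt _).comp
      hL.analyticAt
  have hsum : germOf F hF - algebraMap ℂ _ (F 0) =
      ∑ i, germOf _ (hc i) * germOf (fun z => z i) (analyticAt_coord i 0) := by
    simp_rw [germOf_mul, germOf_sum, algebraMap_eq_germOf, germOf_sub, germOf_eq_iff]
    filter_upwards [hF'] with z hz
    have hz' : z = ∑ i, z i • EuclideanSpace.single i (1 : ℂ) := by
      simpa using ((EuclideanSpace.basisFun (Fin n) ℂ).sum_repr z).symm
    have := congrArg (p.shift.sum z) hz'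
    rw [map_sum] at this
    simp [hz, this, mul_comm]
  rw [hsum, orderIdeal_one_eq_span]
  exact Ideal.sum_mem _ fun i _ => Ideal.mul_mem_left _ _ (Ideal.subset_span ⟨i, rfl⟩)

theorem isUnit_germOf {F : En n → ℂ} {hF : AnalyticAt ℂ F 0} (h : F 0 ≠ 0) :
    IsUnit (germOf F hF) := by
  refine IsUnit.of_mul_eq_one (germOf F⁻¹ (hF.inv h)) ?_
  rw [germOf_mul, ← map_one (algebraMap ℂ _), algebraMap_eq_germOf, germOf_eq_iff]
  filter_upwards [hF.continuousAt.eventually_ne h] with z hz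
  simp [hz]

theorem isLocalModel_polyGerm : IsLocalModel (polyGerm n) where
  exists_const a := by
    obtain ⟨F, hF, rfl⟩ := exists_germOf a
    exact ⟨F 0, germOf_sub_const_mem hF⟩
  eq_zero_of_mem s A hA h := by
    rw [polyGerm_apply] at h
    refine evalE_injective ((eq_zero_of_homogeneous_of_isBigO hA.evalE_smul
      (germOf_mem_bigOIdeal.1 (orderIdeal_le_bigOIdeal _ h))).trans evalE_zero.symm)
  le_jacobson a ha := by
    obtain ⟨F, hF, rfl⟩ := exists_germOf a
    have hF0 : F 0 = 0 := by
      have := germOf_mem_bigOIdeal.1 (orderIdeal_le_bigOIdeal _ ha)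
      exact IsBigO.eq_zero_of_norm_pow (x₀ := 0) (n := 1) (by simpa using! this) one_ne_zero
    rw [Ideal.mem_jacobson_bot]
    intro b
    obtain ⟨G, hG, rfl⟩ := exists_germOf b
    refine isUnit_germOf (F := F * G + fun _ => 1) (hF := (hF.mul hG).add analyticAt_const) ?_
    simp [hF0]

theorem germOf_mem_orderIdeal_iff {F : En n → ℂ} {hF : AnalyticAt ℂ F 0} {s : ℕ} :
    germOf F hF ∈ orderIdeal (polyGerm n) s ↔ F =O[𝓝 0] fun z => ‖z‖ ^ s := by
  refine ⟨fun h => germOf_mem_bigOIdeal.1 (orderIdeal_le_bigOIdeal _ h), fun h => ?_⟩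
  suffices key : ∀ j ≤ s, germOf F hF ∈ orderIdeal (polyGerm n) j from key s le_rfl
  intro j
  induction j with
  | zero => simp [orderIdeal_zero]
  | succ j ih =>
    intro hj
    obtain ⟨A, hA, hFA⟩ := isLocalModel_polyGerm.exists_leadingForm (ih (by omega))
    have hF' : germOf F hF ∈ bigOIdeal n (j + 1) :=
      germOf_mem_bigOIdeal.2 (h.trans (isBigO_norm_pow_of_le hj))
    have hA' : polyGerm n A ∈ bigOIdeal n (j + 1) := by
      simpa using Ideal.sub_mem _ hF' (orderIdeal_le_bigOIdeal _ hFA)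
    rw [polyGerm_apply, germOf_mem_bigOIdeal] at hA'
    have hA0 : A = 0 := evalE_injective
      ((eq_zero_of_homogeneous_of_isBigO hA.evalE_smul hA').trans evalE_zero.symm)
    simpa [hA0] using hFA

end AnalyticGerms

section Milnor

open MvPolynomial Asymptotics

variable {n : ℕ}

theorem analyticAt_partial {F : En n → ℂ} (hF : AnalyticAt ℂ F 0) (i : Fin n) :
    AnalyticAt ℂ (fun z => fderiv ℂ F z (EuclideanSpace.single i 1)) 0 :=
  ((ContinuousLinearMap.apply ℂ ℂ (EuclideanSpace.single i (1 : ℂ) : En n)).analyticAt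
    (fderiv ℂ F 0)).comp hF.fderiv

/-- The partial derivatives on germs. -/
def germPartial (i : Fin n) (a : AnalyticGerms n) : AnalyticGerms n :=
  germOf _ (analyticAt_partial (exists_germOf a).choose_spec.choose i)

theorem germPartial_germOf (i : Fin n) {F : En n → ℂ} (hF : AnalyticAt ℂ F 0) :
    germPartial i (germOf F hF) = germOf _ (analyticAt_partial hF i) := by
  rw [germPartial, germOf_eq_iff]
  have := germOf_eq_iff.1 (exists_germOf (germOf F hF)).choose_spec.choose_spec
  filter_upwards [this.fderiv (𝕜 := ℂ)] with z hz
  rw [← hz]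

theorem germPartial_add (i : Fin n) (a b : AnalyticGerms n) :
    germPartial i (a + b) = germPartial i a + germPartial i b := by
  obtain ⟨F, hF, rfl⟩ := exists_germOf a
  obtain ⟨G, hG, rfl⟩ := exists_germOf b
  simp only [germOf_add, germPartial_germOf, germOf_eq_iff]
  filter_upwards [hF.eventually_analyticAt, hG.eventually_analyticAt] with z hz hz'
  simp [fderiv_add hz.differentiableAt hz'.differentiableAt]

theorem germPartial_mul (i : Fin n) (a b : AnalyticGerms n) :
    germPartial i (a * b) = a * germPartial i b + b * germPartial i a := by
  obtain ⟨F, hF, rfl⟩ := exists_germOf a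
  obtain ⟨G, hG, rfl⟩ := exists_germOf b
  simp only [germOf_add, germOf_mul, germPartial_germOf, germOf_eq_iff]
  filter_upwards [hF.eventually_analyticAt, hG.eventually_analyticAt] with z hz hz'
  simp [fderiv_mul hz.differentiableAt hz'.differentiableAt]

theorem fderiv_evalE (A : MvPolynomial (Fin n) ℂ) (i : Fin n) (z : En n) :
    fderiv ℂ (evalE A) z (EuclideanSpace.single i 1) = evalE (pderiv i A) z := by
  induction A using MvPolynomial.induction_on with
  | C c => simp [evalE_C, evalE_zero]
  | add p q hp hq =>
    rw [evalE_add, fderiv_add (analyticAt_evalE p z).differentiableAt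
      (analyticAt_evalE q z).differentiableAt]
    simp [hp, hq, evalE_add]
  | mul_X p j hp =>
    have hj : fderiv ℂ (fun z : En n => z j) z = EuclideanSpace.proj (𝕜 := ℂ) j :=
      (EuclideanSpace.proj (𝕜 := ℂ) j).fderiv
    rw [evalE_mul_X, fderiv_mul (analyticAt_evalE p z).differentiableAt
      (analyticAt_coord j z).differentiableAt, hj]
    simp only [add_apply, smul_apply, hp, Derivation.leibniz, pderiv_X]
    by_cases h : j = i
    · subst h
      simp [evalE, mul_comm]
    · simp [evalE, h, mul_comm]

theorem germPartial_polyGerm (i : Fin n) (A : MvPolynomial (Fin n) ℂ) :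
    germPartial i (polyGerm n A) = polyGerm n (pderiv i A) := by
  rw [polyGerm_apply, polyGerm_apply, germPartial_germOf, germOf_eq_iff]
  exact .of_forall (fderiv_evalE A i)

theorem germPartial_mem_orderIdeal (i : Fin n) {s : ℕ} {a : AnalyticGerms n}
    (ha : a ∈ orderIdeal (polyGerm n) (s + 1)) :
    germPartial i a ∈ orderIdeal (polyGerm n) s := by
  induction s generalizing a with
  | zero => simp [orderIdeal_zero]
  | succ s ih =>
    rw [orderIdeal_add (s + 1) 1] at ha
    refine Submodule.mul_induction_on ha (fun x hx y hy => ?_) fun x y hx hy => ?_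
    · rw [germPartial_mul]
      refine add_mem (Ideal.mul_mem_right _ _ hx) ?_
      exact mul_mem_orderIdeal hy (ih hx) (by omega)
    · rw [germPartial_add]
      exact add_mem hx hy

theorem jacobianIdeal_eq_span {F : En n → ℂ} (hF : AnalyticAt ℂ F 0) :
    jacobianIdeal F = Ideal.span (Set.range fun i => germPartial i (germOf F hF)) := by
  rw [jacobianIdeal]
  congr 1
  ext g
  constructor
  · rintro ⟨i, hi⟩
    exact ⟨i, (germPartial_germOf i hF).trans (Subtype.ext hi.symm)⟩
  · rintro ⟨i, rfl⟩
    exact ⟨i, by simp only [germPartial_germOf]; rfl⟩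

/-- Variables vanish on the common zeros of a family of polynomials without common zeros outside
the origin. -/
theorem X_mem_radical_span {h : Fin n → MvPolynomial (Fin n) ℂ}
    (hz : ∀ x : Fin n → ℂ, (∀ i, eval x (h i) = 0) → x = 0) (i : Fin n) :
    X i ∈ (Ideal.span (Set.range h)).radical := by
  rw [← vanishingIdeal_zeroLocus_eq_radical (K := ℂ), mem_vanishingIdeal_iff]
  intro x hx
  rw [hz x fun j => hx _ (Ideal.subset_span ⟨j, rfl⟩)]
  simp

/-- A function whose initial homogeneous term `A` has an isolated singularity has the Milnor
number of `A`. -/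
theorem milnorNumber_eq_of_initialTerm {F : En n → ℂ} (hF : AnalyticAt ℂ F 0) {d : ℕ}
    {A : MvPolynomial (Fin n) ℂ} (hA : A.IsHomogeneous (d + 1))
    (hFA : (F - evalE A) =O[𝓝 0] fun z => ‖z‖ ^ (d + 2))
    (hz : ∀ x : Fin n → ℂ, (∀ i, eval x (pderiv i A) = 0) → x = 0) :
    milnorNumber F = milnorNumber (evalE A) := by
  rw [milnorNumber, milnorNumber, jacobianIdeal_eq_span hF,
    jacobianIdeal_eq_span (analyticAt_evalE A 0), ← polyGerm_apply]
  refine finrank_quotient_eq_of_leadingForms isLocalModel_polyGerm (d := d)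
    (h := fun i => pderiv i A) (fun i => hA.pderiv) (fun i => ?_) (fun i => ?_)
    (X_mem_radical_span hz)
  · have h1 : germOf F hF - polyGerm n A ∈ orderIdeal (polyGerm n) (d + 1 + 1) := by
      rw [polyGerm_apply, germOf_sub, germOf_mem_orderIdeal_iff]
      exact hFA
    have h2 := germPartial_mem_orderIdeal i h1
    have h3 := germPartial_add i (germOf F hF - polyGerm n A) (polyGerm n A)
    rw [sub_add_cancel, germPartial_polyGerm] at h3
    simpa [h3] using h2
  · simp [germPartial_polyGerm]

theorem fderiv_eq_zero_of_partial {F : En n → ℂ} {z : En n}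
    (h : ∀ i, fderiv ℂ F z (EuclideanSpace.single i 1) = 0) : fderiv ℂ F z = 0 := by
  ext v
  have hv : v = ∑ i, v i • EuclideanSpace.single i (1 : ℂ) := by
    simpa using ((EuclideanSpace.basisFun (Fin n) ℂ).sum_repr v).symm
  rw [hv, map_sum]
  simp [h]

/-- The homogeneous polynomial whose values are the initial term of a power series. -/
theorem exists_evalE_eq_initialTerm {f : En n → ℂ} {p : FormalMultilinearSeries ℂ (En n) ℂ}
    (hp : HasFPowerSeriesAt f p 0) {k : ℕ} (hlow : ∀ j < k, ∀ z : En n, (p j fun _ => z) = 0)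
    {P : En n → ℂ} (hP : ∀ z : En n, P z = p k fun _ => z) :
    ∃ A : MvPolynomial (Fin n) ℂ, A.IsHomogeneous k ∧ evalE A = P ∧
      (f - P) =O[𝓝 0] fun z => ‖z‖ ^ (k + 1) := by
  have h0 : f =O[𝓝 0] fun z => ‖z‖ ^ k := by
    have := hp.isBigO_sub_partialSum_pow k
    simp only [zero_add, FormalMultilinearSeries.partialSum] at this
    refine this.congr_left fun z => ?_
    rw [Finset.sum_eq_zero fun j hj => hlow j (Finset.mem_range.1 hj) z, sub_zero]
  have h1 : (f - P) =O[𝓝 0] fun z => ‖z‖ ^ (k + 1) := by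
    have := hp.isBigO_sub_partialSum_pow (k + 1)
    simp only [zero_add, FormalMultilinearSeries.partialSum] at this
    refine this.congr_left fun z => ?_
    rw [Finset.sum_range_succ,
      Finset.sum_eq_zero fun j hj => hlow j (Finset.mem_range.1 hj) z, zero_add, Pi.sub_apply, hP]
  obtain ⟨A, hA, hfA⟩ := isLocalModel_polyGerm.exists_leadingForm
    (germOf_mem_orderIdeal_iff (hF := hp.analyticAt).2 h0)
  rw [polyGerm_apply, germOf_sub, germOf_mem_orderIdeal_iff] at hfA
  refine ⟨A, hA, ?_, h1⟩
  have hO : (evalE A - P) =O[𝓝 0] fun z => ‖z‖ ^ (k + 1) := by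
    simpa using! h1.sub hfA
  refine sub_eq_zero.1 (eq_zero_of_homogeneous_of_isBigO (fun c z => ?_) hO)
  have hPc : P (c • z) = c ^ k * P z := by
    rw [hP, hP]
    simpa using (p k).map_smul_univ (fun _ => c) (fun _ => z)
  rw [Pi.sub_apply, Pi.sub_apply, hA.evalE_smul, hPc, mul_sub]

/-- The series `∑ t ^ (j - k) p_j(z)` with `t ≠ 0` sums to `t ^ (-k) f (t z)`. -/
theorem eventuallyEq_tsum_rescale {f : En n → ℂ} {p : FormalMultilinearSeries ℂ (En n) ℂ}
    (hp : HasFPowerSeriesAt f p 0) {k : ℕ} (hlow : ∀ j < k, ∀ z : En n, (p j fun _ => z) = 0)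
    {t : ℂ} (ht : t ≠ 0) :
    (fun z => ∑' j : ℕ, t ^ (j - k) * (p j fun _ => z)) =ᶠ[𝓝 0]
      fun z => (t ^ k)⁻¹ * f (t • z) := by
  have hlim : Filter.Tendsto (fun z : En n => t • z) (𝓝 0) (𝓝 0) := by
    simpa using ((continuous_const_smul t).tendsto (0 : En n))
  filter_upwards [hlim.eventually hp.eventually_hasSum] with z hz
  rw [zero_add] at hz
  refine HasSum.tsum_eq ?_
  refine (hz.mul_left (t ^ k)⁻¹).congr_fun fun j => ?_
  have hj : (p j fun _ => t • z) = t ^ j * p j fun _ => z := by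
    simpa using (p j).map_smul_univ (fun _ => t) (fun _ => z)
  rw [hj]
  rcases lt_or_ge j k with h | h
  · simp [hlow j h z]
  · obtain ⟨m, rfl⟩ := Nat.exists_eq_add_of_le h
    rw [Nat.add_sub_cancel_left, pow_add]
    field_simp

end Milnor

theorem mu_constant_family {n : ℕ}
    (f : En n → ℂ) (hf0 : f 0 = 0)
    -- Taylor expansion `f = f_k + f_{k+1} + ⋯` of `f` at `0`
    (p : FormalMultilinearSeries ℂ (En n) ℂ) (hp : HasFPowerSeriesAt f p 0)
    (k : ℕ) (hlow : ∀ j < k, ∀ z : En n, (p j fun _ => z) = 0)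
    (P : En n → ℂ) (hPdef : ∀ z : En n, P z = p k fun _ => z) (hPne : P ≠ 0)
    -- the initial term `P = f_k` has an isolated singularity at the origin
    (hPsing : ∀ z : En n, fderiv ℂ P z = 0 → z = 0)
    -- the family `H_t = f_k + t f_{k+1} + t² f_{k+2} + ⋯`
    (H : ℝ → En n → ℂ)
    (hH : ∀ t ∈ Set.Icc (0:ℝ) 1, ∀ z : En n,
      H t z = ∑' j : ℕ, ((t:ℂ)) ^ (j - k) * (p j fun _ => z)) :
    milnorNumber f = milnorNumber P ∧
      ∀ t ∈ Set.Icc (0:ℝ) 1, milnorNumber (H t) = milnorNumber f := by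
  obtain ⟨A, hA, rfl, hfA⟩ := exists_evalE_eq_initialTerm hp hlow hPdef
  obtain ⟨d, rfl⟩ : ∃ d, k = d + 1 := by
    refine Nat.exists_eq_succ_of_ne_zero ?_
    rintro rfl
    refine hPne (funext fun z => ?_)
    rw [hPdef, hp.coeff_zero, hf0, Pi.zero_apply]
  have hz : ∀ x : Fin n → ℂ, (∀ i, MvPolynomial.eval x (MvPolynomial.pderiv i A) = 0) → x = 0 := by
    intro x hx
    have := hPsing (WithLp.toLp 2 x) (fderiv_eq_zero_of_partial fun i => by
      rw [fderiv_evalE]; exact hx i)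
    simpa using this
  have key : milnorNumber f = milnorNumber (evalE A) :=
    milnorNumber_eq_of_initialTerm hp.analyticAt hA hfA hz
  refine ⟨key, fun t ht => ?_⟩
  rw [key]
  rcases eq_or_ne t 0 with rfl | ht0
  · congr 1
    funext z
    rw [hH 0 ht, hPdef, tsum_eq_single (d + 1)]
    · simp
    · intro j hj
      rcases hj.lt_or_gt with h | h
      · simp [hlow j h z]
      · simp [Nat.sub_ne_zero_of_lt h]
  · have htc : (t : ℂ) ≠ 0 := Complex.ofReal_ne_zero.2 ht0
    have hHt : H t =ᶠ[𝓝 0] fun z => ((t : ℂ) ^ (d + 1))⁻¹ * f ((t : ℂ) • z) := by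
      rw [funext (hH t ht)]
      exact eventuallyEq_tsum_rescale hp hlow htc
    have hsmul : AnalyticAt ℂ (fun z : En n => (t : ℂ) • z) 0 := by fun_prop
    have hft : AnalyticAt ℂ (fun z : En n => f ((t : ℂ) • z)) 0 :=
      AnalyticAt.fun_comp (by simpa using hp.analyticAt) hsmul
    refine milnorNumber_eq_of_initialTerm ((analyticAt_const.mul hft).congr hHt.symm) hA ?_ hz
    have hlim : Filter.Tendsto (fun z : En n => (t : ℂ) • z) (𝓝 0) (𝓝 0) := by
      simpa using hsmul.continuousAt.tendsto
    have hO := (hfA.comp_tendsto hlim).const_mul_left ((t : ℂ) ^ (d + 1))⁻¹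
    refine (hO.congr' ?_ .rfl).trans (Asymptotics.IsBigO.of_bound (‖t‖ ^ (d + 2)) ?_)
    · filter_upwards [hHt] with z hz
      rw [Function.comp_apply, Pi.sub_apply, Pi.sub_apply, hz, hA.evalE_smul, mul_sub,
        inv_mul_cancel_left₀ (pow_ne_zero _ htc)]
    · exact .of_forall fun z => by simp [norm_smul, mul_pow]
end
end

section
/- (Samuel) Let f : (ℂ^n,0) → (ℂ,0) be a germ of holomorphic function with an isolated singularity at the origin. Then there exists a positive integer N such that the germ V_f is analytically equivalent to V_g, where g is the Taylor polynomial of f at 0 of degree N: there are neighborhoods U, U' of 0 in ℂ^n and a biholomorphism φ : U → U' with φ(0)=0 and φ(f⁻¹(0) ∩ U) = g⁻¹(0) ∩ U'. -/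
open scoped Topology

set_option synthInstance.maxHeartbeats 1000000
set_option maxHeartbeats 1000000

noncomputable section

section Superposition

variable {K F Y : Type*} [TopologicalSpace K] [CompactSpace K]
  [NormedAddCommGroup F] [NormedSpace ℂ F] [NormedAddCommGroup Y] [NormedSpace ℂ Y]

/-- The continuous multilinear map on `C(K, F)` acting pointwise through `p`. -/
def pointwiseMultilinear (K : Type*) [TopologicalSpace K] [CompactSpace K] {k : ℕ}
    (p : F [×k]→L[ℂ] Y) : C(K, F) [×k]→L[ℂ] C(K, Y) :=
  MultilinearMap.mkContinuous
    { toFun := fun g => ⟨fun x => p fun i => g i x, by fun_prop⟩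
      map_update_add' := by
        intro _ m i a b
        ext x
        have key : ∀ c : C(K, F), (fun j => (Function.update m i c j) x)
            = Function.update (fun j => m j x) i (c x) := fun c => by
          ext j
          by_cases h : j = i
          · subst h; simp
          · simp [h]
        simp [key]
      map_update_smul' := by
        intro _ m i c a
        ext x
        have key : ∀ c : C(K, F), (fun j => (Function.update m i c j) x)
            = Function.update (fun j => m j x) i (c x) := fun c => by
          ext j
          by_cases h : j = i
          · subst h; simp
          · simp [h]
        simp [key] }
    ‖p‖ (fun m => by
      rw [ContinuousMap.norm_le _ (by positivity)]
      intro x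
      refine (p.le_opNorm _).trans ?_
      gcongr with i
      exact (m i).norm_coe_le_norm x)

theorem norm_pointwiseMultilinear_le {k : ℕ} (p : F [×k]→L[ℂ] Y) :
    ‖pointwiseMultilinear K p‖ ≤ ‖p‖ :=
  MultilinearMap.mkContinuous_norm_le _ (norm_nonneg _) _

/-- Superposition with an analytic function is analytic on spaces of continuous functions. -/
theorem HasFPowerSeriesOnBall.exists_superposition [CompleteSpace Y] {a : F → Y}
    {p : FormalMultilinearSeries ℂ F Y} {R : ENNReal} (ha : HasFPowerSeriesOnBall a p 0 R) :
    ∃ A : C(K, F) → C(K, Y), AnalyticOnNhd ℂ A (Metric.eball 0 R) ∧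
      ∀ g ∈ Metric.eball (0 : C(K, F)) R, ∀ x, A g x = a (g x) := by
  let q : FormalMultilinearSeries ℂ C(K, F) C(K, Y) := fun k => pointwiseMultilinear K (p k)
  have hrad : R ≤ q.radius := by
    refine ha.r_le.trans ?_
    exact FormalMultilinearSeries.radius_le_of_le
      (fun k => norm_pointwiseMultilinear_le (p k))
  have hq : HasFPowerSeriesOnBall q.sum q 0 R :=
    (q.hasFPowerSeriesOnBall (ha.r_pos.trans_le hrad)).mono ha.r_pos hrad
  refine ⟨q.sum, hq.analyticOnNhd, fun g hg x => ?_⟩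
  have h1 := hq.hasSum hg
  rw [zero_add] at h1
  have h2 : HasSum (fun k => p k fun _ => g x) (q.sum g x) :=
    h1.mapL (ContinuousMap.evalCLM ℂ x)
  have h3 := ha.hasSum (y := g x) (by
    rw [mem_eball_zero_iff] at hg ⊢
    refine lt_of_le_of_lt ?_ hg
    rw [enorm_le_iff_norm_le]
    exact g.norm_coe_le_norm x)
  rw [zero_add] at h3
  exact h2.unique h3

end Superposition

section Mean

variable {Y : Type*} [NormedAddCommGroup Y] [NormedSpace ℂ Y]

/-- The mean value over the unit interval, as a continuous linear map. -/
def meanCLM (Y : Type*) [NormedAddCommGroup Y] [NormedSpace ℂ Y] : C(unitInterval, Y) →L[ℂ] Y :=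
  LinearMap.mkContinuous
    { toFun := fun h => ∫ t in (0 : ℝ)..1, h (Set.projIcc 0 1 zero_le_one t)
      map_add' := fun a b => by
        refine intervalIntegral.integral_add ?_ ?_ <;>
        exact Continuous.intervalIntegrable (by fun_prop) _ _
      map_smul' := fun c a => by
        exact intervalIntegral.integral_smul c _ }
    1 (fun h => by
      have := intervalIntegral.norm_integral_le_of_norm_le_const (a := (0 : ℝ)) (b := 1) (C := ‖h‖)
        (f := fun t => h (Set.projIcc 0 1 zero_le_one t)) (fun t _ => h.norm_coe_le_norm _)
      simpa using this)

theorem meanCLM_apply (h : C(unitInterval, Y)) (H : ℝ → Y)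
    (hH : ∀ t : unitInterval, h t = H t) : meanCLM Y h = ∫ t in (0 : ℝ)..1, H t := by
  change ∫ t in (0 : ℝ)..1, h (Set.projIcc 0 1 zero_le_one t) = _
  refine intervalIntegral.integral_congr fun t ht => ?_
  rw [Set.uIcc_of_le zero_le_one] at ht
  simp only [hH, Set.projIcc_of_mem zero_le_one ht]

end Mean

section Hadamard

variable {E Y : Type*} [NormedAddCommGroup E] [NormedSpace ℂ E]
  [NormedAddCommGroup Y] [NormedSpace ℂ Y] [CompleteSpace Y]

/-- The segment `t ↦ z + t v`, as a continuous linear function of `(z, v)`. -/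
def segmentCLM (E : Type*) [NormedAddCommGroup E] [NormedSpace ℂ E] :
    E × E →L[ℂ] C(unitInterval, E) :=
  LinearMap.mkContinuous
    { toFun := fun x => ⟨fun t => x.1 + ((t : ℝ) : ℂ) • x.2, by fun_prop⟩
      map_add' := fun x y => by
        ext t
        simp only [ContinuousMap.coe_mk, ContinuousMap.add_apply, Prod.fst_add, Prod.snd_add,
          smul_add]
        abel
      map_smul' := fun c x => by
        ext t
        simp only [ContinuousMap.coe_mk, ContinuousMap.smul_apply, Prod.smul_fst, Prod.smul_snd,
          smul_add, RingHom.id_apply, smul_comm c] }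
    2 (fun x => by
      rw [ContinuousMap.norm_le _ (by positivity)]
      intro t
      have h1 : ‖(((t : ℝ) : ℂ)) • x.2‖ ≤ 1 * ‖x.2‖ := by
        rw [norm_smul]
        gcongr
        rw [Complex.norm_real, Real.norm_eq_abs, abs_of_nonneg t.2.1]
        exact t.2.2
      have h2 := norm_add_le x.1 (((t : ℝ) : ℂ) • x.2)
      have h3 := norm_fst_le x
      have h4 := norm_snd_le x
      simp only [ContinuousMap.coe_mk, LinearMap.coe_mk, AddHom.coe_mk]
      linarith)

theorem segmentCLM_apply (x : E × E) (t : unitInterval) :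
    segmentCLM E x t = x.1 + ((t : ℝ) : ℂ) • x.2 := rfl

/-- Hadamard's lemma: the increment of an analytic function is an analytic linear form in the
increment of the variable. -/
theorem AnalyticAt.exists_increment_eq {f : E → Y} (hf : AnalyticAt ℂ f 0) :
    ∃ G : E × E → (E →L[ℂ] Y), AnalyticAt ℂ G 0 ∧
      (∀ᶠ x in 𝓝 (0 : E × E), f (x.1 + x.2) - f x.1 = G x x.2) ∧
      ∀ᶠ z in 𝓝 (0 : E), G (z, 0) = fderiv ℂ f z := by
  obtain ⟨p, R, hp⟩ := hf.fderiv
  have hf' : ∀ᶠ z in 𝓝 (0 : E), AnalyticAt ℂ f z := hf.eventually_analyticAt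
  obtain ⟨ε, hε, hfε⟩ := Metric.eventually_nhds_iff_ball.1 hf'
  obtain ⟨A, hA, hAe⟩ := hp.exists_superposition (K := unitInterval)
  have hev : ∀ᶠ x in 𝓝 (0 : E × E), segmentCLM E x ∈ Metric.eball 0 R ∩ Metric.ball 0 ε := by
    refine (segmentCLM E).continuous.continuousAt.eventually_mem ?_
    rw [map_zero]
    exact Filter.inter_mem (Metric.eball_mem_nhds _ hp.r_pos) (Metric.ball_mem_nhds _ hε)
  refine ⟨fun x => meanCLM _ (A (segmentCLM E x)), ?_, ?_, ?_⟩
  · refine ((meanCLM _).analyticAt _).comp (AnalyticAt.comp (g := A) ?_ ((segmentCLM E).analyticAt _))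
    rw [map_zero]
    exact hA _ (Metric.mem_eball_self hp.r_pos)
  · filter_upwards [hev] with x ⟨hx, hxε⟩
    have hseg : ∀ t ∈ Set.uIcc (0 : ℝ) 1, AnalyticAt ℂ f (x.1 + (t : ℂ) • x.2) := by
      intro t ht
      rw [Set.uIcc_of_le zero_le_one] at ht
      apply hfε
      rw [mem_ball_zero_iff] at hxε ⊢
      exact ((segmentCLM E x).norm_coe_le_norm ⟨t, ht⟩).trans_lt hxε
    have hcont : ContinuousOn (fun t : ℝ => fderiv ℂ f (x.1 + (t : ℂ) • x.2)) (Set.uIcc 0 1) := by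
      intro t ht
      have h1 : ContinuousAt (fderiv ℂ f) (x.1 + (t : ℂ) • x.2) := (hseg t ht).fderiv.continuousAt
      refine ContinuousAt.continuousWithinAt ?_
      exact ContinuousAt.comp (f := fun t : ℝ => x.1 + (t : ℂ) • x.2) h1 (by fun_prop)
    rw [meanCLM_apply _ (fun t : ℝ => fderiv ℂ f (x.1 + (t : ℂ) • x.2))
      (fun t => by rw [hAe _ hx, segmentCLM_apply])]
    rw [ContinuousLinearMap.intervalIntegral_apply hcont.intervalIntegrable]
    have := intervalIntegral.integral_eq_sub_of_hasDerivAt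
      (f := fun t : ℝ => f (x.1 + (t : ℂ) • x.2))
      (f' := fun t : ℝ => fderiv ℂ f (x.1 + (t : ℂ) • x.2) x.2) (a := 0) (b := 1) ?_ ?_
    · rw [this]; simp
    · intro t ht
      have h1 := (hseg t ht).differentiableAt.hasFDerivAt
      have h2 : HasDerivAt (fun t : ℝ => x.1 + (t : ℂ) • x.2) x.2 t := by
        have := ((Complex.ofRealCLM.hasDerivAt (x := t)).smul_const x.2).const_add x.1
        simpa using this
      exact (h1.restrictScalars ℝ).comp_hasDerivAt t h2
    · exact (hcont.clm_apply continuousOn_const).intervalIntegrable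
  · have h0 : ∀ᶠ z in 𝓝 (0 : E), segmentCLM E (z, 0) ∈ Metric.eball 0 R ∩ Metric.ball 0 ε := by
      have : Filter.Tendsto (fun z : E => (z, (0 : E))) (𝓝 0) (𝓝 0) :=
        Continuous.tendsto' (by fun_prop) _ _ rfl
      exact this.eventually hev
    filter_upwards [h0] with z ⟨hz, _⟩
    rw [meanCLM_apply _ (fun _ : ℝ => fderiv ℂ f z)
      (fun t => by rw [hAe _ hz, segmentCLM_apply]; simp)]
    simp

end Hadamard

section Inverse

variable {E X Y : Type*} [NormedAddCommGroup E] [NormedSpace ℂ E] [NormedAddCommGroup X]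
  [NormedSpace ℂ X] [CompleteSpace X] [NormedAddCommGroup Y] [NormedSpace ℂ Y]

theorem AnalyticAt.inverse_one_sub {T : E → X →L[ℂ] X} {z : E} (hT : AnalyticAt ℂ T z)
    (h0 : T z = 0) : AnalyticAt ℂ (fun z => Ring.inverse (1 - T z)) z := by
  have h1 := analyticAt_inverse_one_sub ℂ (X →L[ℂ] X)
  rw [← h0] at h1
  exact h1.comp hT

theorem AnalyticAt.comp_inverse_one_sub (l : X →L[ℂ] Y) {T : E → X →L[ℂ] X} {z : E}
    (hT : AnalyticAt ℂ T z) (h0 : T z = 0) :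
    AnalyticAt ℂ (fun z => l ∘L Ring.inverse (1 - T z)) z :=
  ((ContinuousLinearMap.compL ℂ X X Y l).analyticAt _).comp (hT.inverse_one_sub h0)

theorem AnalyticAt.eventually_isUnit_one_sub {T : E → X →L[ℂ] X} {z : E} (hT : AnalyticAt ℂ T z)
    (h0 : T z = 0) : ∀ᶠ y in 𝓝 z, IsUnit (1 - T y) := by
  have h1 : ContinuousAt (fun y => 1 - T y) z := continuousAt_const.sub hT.continuousAt
  refine h1.eventually_mem (Units.isOpen.mem_nhds ?_)
  simp [h0]

theorem inverse_one_sub_mem_of_isClosed {W : Submodule ℂ X} (hW : IsClosed (W : Set X))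
    {T : X →L[ℂ] X} (hT : ‖T‖ < 1) (hTW : ∀ x ∈ W, T x ∈ W) {x : X} (hx : x ∈ W) :
    Ring.inverse (1 - T) x ∈ W := by
  have h1 := (hasSum_geom_series_inverse T hT).mapL
    (ContinuousLinearMap.apply ℂ X x)
  refine hW.mem_of_tendsto h1 (Filter.Eventually.of_forall fun s => ?_)
  refine W.sum_mem fun k hk => ?_
  clear hk
  induction k with
  | zero => simpa using hx
  | succ k ih =>
    rw [pow_succ']
    exact hTW _ ih

end Inverse

section Circle

open Metric

/-- The coordinate function on the circle of radius `r`, parametrised by the unit interval. -/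
def circleCoord (r : ℝ) : C(unitInterval, ℂ) :=
  ⟨fun t => circleMap 0 r (2 * Real.pi * t), by fun_prop⟩

theorem norm_circleCoord_apply {r : ℝ} (hr : 0 < r) (t : unitInterval) : ‖circleCoord r t‖ = r := by
  simp [circleCoord, abs_of_pos hr]

theorem circleCoord_apply_ne_zero {r : ℝ} (hr : 0 < r) (t : unitInterval) :
    circleCoord r t ≠ 0 := by
  rw [← norm_pos_iff, norm_circleCoord_apply hr]
  exact hr

/-- The inverse of the coordinate function on the circle of radius `r`. -/
def circleCoordInv {r : ℝ} (hr : 0 < r) : C(unitInterval, ℂ) :=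
  ⟨fun t => (circleCoord r t)⁻¹,
    (circleCoord r).continuous.inv₀ (circleCoord_apply_ne_zero hr)⟩

/-- The backward shift `h ↦ (h - h(0)) / w`, where `h(0)` is computed as a mean value. -/
def backwardShift {r : ℝ} (hr : 0 < r) : C(unitInterval, ℂ) →L[ℂ] C(unitInterval, ℂ) :=
  (ContinuousLinearMap.mul ℂ _ (circleCoordInv hr)) ∘L
    (ContinuousLinearMap.id ℂ _ - (meanCLM ℂ).smulRight (1 : C(unitInterval, ℂ)))

theorem backwardShift_apply {r : ℝ} (hr : 0 < r) (h : C(unitInterval, ℂ)) (t : unitInterval) :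
    backwardShift hr h t = (circleCoord r t)⁻¹ * (h t - meanCLM ℂ h) := by
  simp [backwardShift, circleCoordInv, mul_sub, mul_comm]

theorem circleCoord_mul_backwardShift {r : ℝ} (hr : 0 < r) (h : C(unitInterval, ℂ)) :
    circleCoord r * backwardShift hr h = h - meanCLM ℂ h • 1 := by
  ext t
  have := circleCoord_apply_ne_zero hr t
  simp [backwardShift_apply, this]

theorem eq_sum_add_pow_mul_backwardShift {r : ℝ} (hr : 0 < r) (h : C(unitInterval, ℂ)) (d : ℕ) :
    h = ∑ j ∈ Finset.range d, meanCLM ℂ ((backwardShift hr ^ j) h) • circleCoord r ^ j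
      + circleCoord r ^ d * (backwardShift hr ^ d) h := by
  induction d with
  | zero => simp
  | succ d ih =>
    rw [Finset.sum_range_succ, pow_succ (circleCoord r), mul_assoc, pow_succ' (backwardShift hr),
      mul_apply_eq_comp, circleCoord_mul_backwardShift, mul_sub]
    conv_lhs => rw [ih]
    simp only [mul_smul_comm, mul_one]
    abel

/-- Restrictions to the circle of radius `r` of holomorphic functions on the disc of
radius `R`. -/
def holoRestrictions (r R : ℝ) : Subalgebra ℂ C(unitInterval, ℂ) where
  carrier := {h | ∃ H : ℂ → ℂ, DifferentiableOn ℂ H (ball 0 R) ∧ ∀ t, h t = H (circleCoord r t)}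
  mul_mem' := by
    rintro a b ⟨A, hA, hA'⟩ ⟨B, hB, hB'⟩
    exact ⟨A * B, hA.mul hB, fun t => by simp [hA', hB']⟩
  add_mem' := by
    rintro a b ⟨A, hA, hA'⟩ ⟨B, hB, hB'⟩
    exact ⟨A + B, hA.add hB, fun t => by simp [hA', hB']⟩
  algebraMap_mem' := fun c => ⟨fun _ => c, by fun_prop, fun t => by simp⟩

variable {r R : ℝ}

theorem circleCoord_apply_mem_ball (hr : 0 < r) (hrR : r < R) (t : unitInterval) :
    circleCoord r t ∈ ball (0 : ℂ) R := by
  rwa [mem_ball_zero_iff, norm_circleCoord_apply hr]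

theorem meanCLM_holo (hr : 0 < r) (hrR : r < R) {H : ℂ → ℂ} (hH : DifferentiableOn ℂ H (ball 0 R))
    {h : C(unitInterval, ℂ)} (hh : ∀ t, h t = H (circleCoord r t)) : meanCLM ℂ h = H 0 := by
  have h1 : DiffContOnCl ℂ H (ball 0 |r|) := by
    rw [abs_of_pos hr]
    exact (hH.mono (closedBall_subset_ball hrR)).diffContOnCl_ball subset_rfl
  rw [← h1.circleAverage, meanCLM_apply h (fun t => H (circleMap 0 r (2 * Real.pi * t))) hh,
    Real.circleAverage_def]
  have := intervalIntegral.integral_comp_mul_left (a := 0) (b := 1)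
    (fun θ : ℝ => H (circleMap 0 r θ)) (c := 2 * Real.pi) (by positivity)
  simpa using this

theorem backwardShift_holo (hr : 0 < r) (hrR : r < R) {H : ℂ → ℂ}
    (hH : DifferentiableOn ℂ H (ball 0 R))
    {h : C(unitInterval, ℂ)} (hh : ∀ t, h t = H (circleCoord r t)) :
    backwardShift hr h ∈ holoRestrictions r R := by
  refine ⟨dslope H 0, ?_, fun t => ?_⟩
  · rwa [Complex.differentiableOn_dslope (ball_mem_nhds _ (hr.trans hrR))]
  · rw [backwardShift_apply, meanCLM_holo hr hrR hH hh,
      dslope_of_ne _ (circleCoord_apply_ne_zero hr t), slope_def_field, hh, sub_zero]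
    field_simp

theorem backwardShift_mem_closure (hr : 0 < r) (hrR : r < R) {h : C(unitInterval, ℂ)}
    (hh : h ∈ (holoRestrictions r R).topologicalClosure) :
    backwardShift hr h ∈ (holoRestrictions r R).topologicalClosure := by
  refine map_mem_closure (backwardShift hr).continuous hh ?_
  rintro a ⟨H, hH, hh⟩
  exact backwardShift_holo hr hrR hH hh

/-- The value at `w` of the function with boundary values given on the circle. -/
def boundaryEval (hr : 0 < r) (w : ℂ) : C(unitInterval, ℂ) →L[ℂ] ℂ :=
  meanCLM ℂ ∘L Ring.inverse (1 - w • backwardShift hr)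

theorem analyticAt_boundaryEval (hr : 0 < r) : AnalyticAt ℂ (boundaryEval hr) 0 := by
  refine AnalyticAt.comp_inverse_one_sub (meanCLM ℂ) (T := fun w : ℂ => w • backwardShift hr) ?_
    (zero_smul _ _)
  exact analyticAt_id.smul analyticAt_const

theorem boundaryEval_holo (hr : 0 < r) (hrR : r < R) {w : ℂ} (hw : w ∈ ball (0 : ℂ) R)
    (hu : IsUnit (1 - w • backwardShift hr)) {H : ℂ → ℂ} (hH : DifferentiableOn ℂ H (ball 0 R))
    {h : C(unitInterval, ℂ)} (hh : ∀ t, h t = H (circleCoord r t)) :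
    boundaryEval hr w h = H w := by
  have hG : DifferentiableOn ℂ (dslope (fun z => z * H z) w) (ball 0 R) := by
    rw [Complex.differentiableOn_dslope (isOpen_ball.mem_nhds hw)]
    exact differentiableOn_id.mul hH
  have hG0 : dslope (fun z => z * H z) w 0 = H w := by
    rcases eq_or_ne w 0 with rfl | hw0
    · have h1 : DifferentiableAt ℂ H 0 := hH.differentiableAt (isOpen_ball.mem_nhds hw)
      rw [dslope_same, deriv_fun_mul differentiableAt_fun_id h1]
      simp
    · rw [dslope_of_ne _ hw0.symm, slope_def_field]
      field_simp
      ring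
  let g : C(unitInterval, ℂ) := ⟨fun t => dslope (fun z => z * H z) w (circleCoord r t),
    hG.continuousOn.comp_continuous (circleCoord r).continuous
      (circleCoord_apply_mem_ball hr hrR)⟩
  have hg : meanCLM ℂ g = H w := by
    rw [meanCLM_holo hr hrR hG (h := g) (fun _ => rfl), hG0]
  have hgh : (1 - w • backwardShift hr) g = h := by
    ext t
    have hz := circleCoord_apply_ne_zero hr t
    have h2 := sub_smul_dslope (fun z => z * H z) w (circleCoord r t)
    simp only [smul_eq_mul] at h2
    simp only [sub_apply, one_apply_eq_self,
      smul_apply, ContinuousMap.sub_apply, ContinuousMap.smul_apply,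
      backwardShift_apply, hg, hh, smul_eq_mul]
    change dslope (fun z => z * H z) w (circleCoord r t) - w * ((circleCoord r t)⁻¹ *
      (dslope (fun z => z * H z) w (circleCoord r t) - H w)) = _
    field_simp
    linear_combination h2
  rw [boundaryEval, ContinuousLinearMap.comp_apply, ← hgh, ← mul_apply_eq_comp,
    Ring.inverse_mul_cancel _ hu, one_apply_eq_self, hg]

theorem boundaryEval_mul (hr : 0 < r) (hrR : r < R) {w : ℂ} (hw : w ∈ ball (0 : ℂ) R)
    (hu : IsUnit (1 - w • backwardShift hr)) {a b : C(unitInterval, ℂ)}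
    (ha : a ∈ (holoRestrictions r R).topologicalClosure)
    (hb : b ∈ (holoRestrictions r R).topologicalClosure) :
    boundaryEval hr w (a * b) = boundaryEval hr w a * boundaryEval hr w b := by
  have h := map_mem_closure₂ (u := {(0 : ℂ)})
    (f := fun a b => boundaryEval hr w (a * b) - boundaryEval hr w a * boundaryEval hr w b)
    (by fun_prop) ha hb ?_
  · rw [closure_singleton, Set.mem_singleton_iff] at h
    exact sub_eq_zero.1 h
  · rintro a ⟨A, hA, hA'⟩ b ⟨B, hB, hB'⟩
    rw [Set.mem_singleton_iff, sub_eq_zero, boundaryEval_holo hr hrR hw hu hA hA',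
      boundaryEval_holo hr hrR hw hu hB hB',
      boundaryEval_holo hr hrR hw hu (hA.mul hB) (h := a * b) (fun t => by simp [hA', hB'])]
    rfl

end Circle

section Division

open Metric

variable {E : Type*} [NormedAddCommGroup E] [NormedSpace ℂ E]

theorem AnalyticAt.continuousLinearMap_apply {X Y : Type*} [NormedAddCommGroup X] [NormedSpace ℂ X]
    [NormedAddCommGroup Y] [NormedSpace ℂ Y] {F : E → X →L[ℂ] Y} {g : E → X} {z : E}
    (hF : AnalyticAt ℂ F z) (hg : AnalyticAt ℂ g z) : AnalyticAt ℂ (fun z => F z (g z)) z :=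
  ((ContinuousLinearMap.id ℂ (X →L[ℂ] Y)).analyticAt_bilinear (F z, g z)).comp₂ hF hg

theorem AnalyticAt.mul_const_clm {X : Type*} [NormedAddCommGroup X] [NormedSpace ℂ X]
    {F : E → X →L[ℂ] X} {z : E} (hF : AnalyticAt ℂ F z) (S : X →L[ℂ] X) :
    AnalyticAt ℂ (fun z => F z * S) z :=
  hF.mul analyticAt_const

theorem AnalyticAt.eventually_norm_lt_one {Y : Type*} [NormedAddCommGroup Y] [NormedSpace ℂ Y]
    {F : E → Y} {z : E} (hF : AnalyticAt ℂ F z) (h0 : F z = 0) : ∀ᶠ y in 𝓝 z, ‖F y‖ < 1 :=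
  hF.continuousAt.norm.eventually_lt continuousAt_const (by simp [h0])

theorem AnalyticAt.exists_circle_family {a : ℂ × E → ℂ} (ha : AnalyticAt ℂ a 0) :
    ∃ ρ : ℝ, 0 < ρ ∧ ∀ R r : ℝ, 0 < r → r < R → R ≤ ρ → ∃ α : E → C(unitInterval, ℂ),
      AnalyticAt ℂ α 0 ∧ (∀ᶠ z in 𝓝 (0 : E), ∀ t, α z t = a (circleCoord r t, z)) ∧
      ∀ᶠ z in 𝓝 (0 : E), DifferentiableOn ℂ (fun w => a (w, z)) (ball 0 R) := by
  obtain ⟨p, R₀, hp⟩ := ha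
  obtain ⟨ρ, hρ0, hρ⟩ := ENNReal.lt_iff_exists_nnreal_btwn.1 hp.r_pos
  replace hp := hp.mono hρ0 hρ.le
  rw [ENNReal.coe_pos] at hρ0
  refine ⟨ρ, hρ0, fun R r hr hrR hRρ => ?_⟩
  obtain ⟨A, hA, hAa⟩ := hp.exists_superposition (K := unitInterval)
  have hd := hp.analyticOnNhd
  rw [Metric.eball_coe] at hA hAa hd
  let emb : E → C(unitInterval, ℂ × E) := fun z => (circleCoord r).prodMk (ContinuousMap.const _ z)
  have hemb : AnalyticAt ℂ emb 0 := by
    have h1 : emb = fun z => emb 0 + (ContinuousLinearMap.const ℂ unitInterval ∘L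
        ContinuousLinearMap.inr ℂ ℂ E) z := by
      ext z t <;> simp [emb]
    rw [h1]
    exact analyticAt_const.add (ContinuousLinearMap.analyticAt _ _)
  have hmem : ∀ z, ‖z‖ < ρ → emb z ∈ ball 0 (ρ : ℝ) := by
    intro z hz
    rw [mem_ball_zero_iff, ContinuousMap.norm_lt_iff _ (NNReal.coe_pos.2 hρ0)]
    intro t
    rw [Prod.norm_def]
    exact max_lt ((norm_circleCoord_apply hr t).trans_lt (hrR.trans_le hRρ)) hz
  have hnhds : ∀ᶠ z in 𝓝 (0 : E), ‖z‖ < ρ := by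
    simpa using eventually_norm_sub_lt (0 : E) (NNReal.coe_pos.2 hρ0)
  refine ⟨A ∘ emb, (hA _ (hmem 0 (by simpa))).comp hemb, ?_, ?_⟩
  · filter_upwards [hnhds] with z hz t
    exact hAa _ (hmem z hz) t
  · filter_upwards [hnhds] with z hz w hw
    have hw' : ‖w‖ < R := by simpa using hw
    have h1 : AnalyticAt ℂ a (w, z) := hd _ (by
      rw [mem_ball_zero_iff, Prod.norm_def]
      exact max_lt (hw'.trans_le hRρ) hz)
    exact (h1.differentiableAt.comp w (f := fun w => (w, z))
      (by fun_prop)).differentiableWithinAt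

theorem weierstrass_division {a b : ℂ × E → ℂ} (ha : AnalyticAt ℂ a 0) (hb : AnalyticAt ℂ b 0)
    {d : ℕ} (had : ∀ᶠ w in 𝓝 (0 : ℂ), a (w, 0) = w ^ d) :
    ∃ q : ℂ × E → ℂ, AnalyticAt ℂ q 0 ∧ ∃ c : ℕ → E → ℂ, (∀ j, AnalyticAt ℂ (c j) 0) ∧
      ∀ᶠ x in 𝓝 (0 : ℂ × E), b x = q x * a x + ∑ j ∈ Finset.range d, c j x.2 * x.1 ^ j := by
  obtain ⟨ρ₁, hρ₁, Ha⟩ := ha.exists_circle_family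
  obtain ⟨ρ₂, hρ₂, Hb⟩ := hb.exists_circle_family
  obtain ⟨ρ₃, hρ₃, hd⟩ := Metric.eventually_nhds_iff_ball.1 had
  obtain ⟨R, hR, hR1, hR2, hR3⟩ : ∃ R : ℝ, 0 < R ∧ R ≤ ρ₁ ∧ R ≤ ρ₂ ∧ R ≤ ρ₃ :=
    ⟨min ρ₁ (min ρ₂ ρ₃), by positivity, by simp, by simp, by simp⟩
  obtain ⟨r, hr, hrR⟩ := exists_between hR
  obtain ⟨α, hα, hαa, hαd⟩ := Ha R r hr hrR hR1
  obtain ⟨β, hβ, hβb, hβd⟩ := Hb R r hr hrR hR2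
  set ζ := circleCoord r with hζ
  set Q := backwardShift hr with hQ
  let W := (holoRestrictions r R).topologicalClosure
  have hQW : ∀ j, ∀ x ∈ W, (Q ^ j) x ∈ W := by
    intro j x hx
    induction j with
    | zero => simpa using hx
    | succ j ih =>
      rw [pow_succ', mul_apply_eq_comp]
      exact backwardShift_mem_closure hr hrR ih
  have hζW : ∀ j, ζ ^ j ∈ W := fun j =>
    subset_closure ⟨fun w => w ^ j, by fun_prop, fun t => by simp [hζ]⟩
  let T : E → C(unitInterval, ℂ) →L[ℂ] C(unitInterval, ℂ) := fun z =>
    ContinuousLinearMap.mul ℂ _ (ζ ^ d - α z) * Q ^ d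
  have hT : AnalyticAt ℂ T 0 := by
    have h1 : AnalyticAt ℂ (fun g => ContinuousLinearMap.mul ℂ C(unitInterval, ℂ) g)
        (ζ ^ d - α 0) := ContinuousLinearMap.analyticAt _ _
    have h2 : AnalyticAt ℂ (fun z => ζ ^ d - α z) 0 := analyticAt_const.sub hα
    exact AnalyticAt.mul_const_clm (h1.comp_of_eq h2 rfl) (Q ^ d)
  have hT0 : T 0 = 0 := by
    have h1 : ζ ^ d - α 0 = 0 := by
      ext t
      have h2 := hαa.self_of_nhds t
      have h3 := hd (ζ t) (ball_subset_ball hR3 (circleCoord_apply_mem_ball hr hrR t))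
      rw [ContinuousMap.sub_apply, h2, h3, ContinuousMap.pow_apply, sub_self]
      rfl
    simp only [T, h1, map_zero, zero_mul]
  let h : E → C(unitInterval, ℂ) := fun z => Ring.inverse (1 - T z) (β z)
  have hh : AnalyticAt ℂ h 0 := (hT.inverse_one_sub hT0).continuousLinearMap_apply hβ
  have hWall : ∀ᶠ z in 𝓝 (0 : E), α z ∈ W ∧ β z ∈ W ∧ h z ∈ W ∧
      β z = h z - T z (h z) ∧ (DifferentiableOn ℂ (fun w => a (w, z)) (ball 0 R)) ∧
      (DifferentiableOn ℂ (fun w => b (w, z)) (ball 0 R)) ∧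
      (∀ t, α z t = a (circleCoord r t, z)) ∧ (∀ t, β z t = b (circleCoord r t, z)) := by
    have hTn := hT.eventually_norm_lt_one hT0
    filter_upwards [hαa, hαd, hβb, hβd, hTn, hT.eventually_isUnit_one_sub hT0]
      with z h1 h2 h3 h4 h5 h6
    have hαW : α z ∈ W := subset_closure ⟨_, h2, h1⟩
    have hβW : β z ∈ W := subset_closure ⟨_, h4, h3⟩
    refine ⟨hαW, hβW, ?_, ?_, h2, h4, h1, h3⟩
    · refine inverse_one_sub_mem_of_isClosed (W := Subalgebra.toSubmodule W)
        (Subalgebra.isClosed_topologicalClosure _) h5 (fun x hx => ?_) hβW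
      exact W.mul_mem (W.sub_mem (hζW d) hαW) (hQW d x hx)
    · have : (1 - T z) (h z) = β z := by
        simp only [h]
        rw [← mul_apply_eq_comp, Ring.mul_inverse_cancel _ h6, one_apply_eq_self]
      rw [← this, sub_apply, one_apply_eq_self]
  refine ⟨fun x => boundaryEval hr x.1 ((Q ^ d) (h x.2)), ?_,
    fun j z => meanCLM ℂ ((Q ^ j) (h z)), fun j => ?_, ?_⟩
  · have h1 : AnalyticAt ℂ (fun x : ℂ × E => boundaryEval hr x.1) 0 :=
      (analyticAt_boundaryEval hr).comp_of_eq analyticAt_fst rfl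
    have h2 : AnalyticAt ℂ (fun x : ℂ × E => h x.2) 0 := hh.comp_of_eq analyticAt_snd rfl
    exact h1.continuousLinearMap_apply (((Q ^ d).analyticAt _).comp h2)
  · exact ((meanCLM ℂ ∘L (Q ^ j)).analyticAt _).comp hh
  · have hU : ∀ᶠ w in 𝓝 (0 : ℂ), IsUnit (1 - w • Q) ∧ w ∈ ball (0 : ℂ) R := by
      refine Filter.Eventually.and ?_ (ball_mem_nhds _ hR)
      exact AnalyticAt.eventually_isUnit_one_sub (T := fun w : ℂ => w • Q)
        (analyticAt_id.smul analyticAt_const) (zero_smul _ _)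
    have := hU.prod_nhds hWall
    rw [← Prod.mk_zero_zero]
    filter_upwards [this]
    rintro ⟨w, z⟩ ⟨⟨hu, hw⟩, hαW, hβW, hhW, hβeq, had, hbd, hae, hbe⟩
    have hev := congrArg (boundaryEval hr w)
      (show β z = ∑ j ∈ Finset.range d, meanCLM ℂ ((Q ^ j) (h z)) • ζ ^ j + (Q ^ d) (h z) * α z by
        rw [hβeq]
        conv_lhs => enter [1]; rw [eq_sum_add_pow_mul_backwardShift hr (h z) d]
        simp only [T, mul_apply_eq_comp, ContinuousLinearMap.mul_apply']
        ring)
    rw [map_add, map_sum, boundaryEval_mul hr hrR hw hu (hQW d _ hhW) hαW,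
      boundaryEval_holo hr hrR hw hu had hae, boundaryEval_holo hr hrR hw hu hbd hbe] at hev
    rw [hev, add_comm]
    congr 1
    refine Finset.sum_congr rfl fun j _ => ?_
    rw [map_smul, smul_eq_mul]
    congr 1
    exact boundaryEval_holo hr hrR hw hu (H := fun w => w ^ j) (by fun_prop)
      (fun t => by simp [hζ])

end Division

section Elimination

open Polynomial

theorem Polynomial.X_pow_dvd_of_eventually_eval_eq {p : ℂ[X]} {d : ℕ} {g : ℂ → ℂ}
    (hg : ContinuousAt g 0) (h : ∀ᶠ w in 𝓝 (0 : ℂ), p.eval w = w ^ d * g w) : X ^ d ∣ p := by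
  induction d generalizing g with
  | zero => simp
  | succ d ih =>
    obtain ⟨r, rfl⟩ := ih (g := fun w => w * g w) (by fun_prop)
      (h.mono fun w hw => by rw [hw]; ring)
    rw [pow_succ]
    refine mul_dvd_mul_left _ (X_dvd_iff.2 ?_)
    rw [coeff_zero_eq_eval_zero]
    have h1 : ∀ᶠ w in 𝓝[≠] (0 : ℂ), r.eval w = w * g w := by
      filter_upwards [h.filter_mono nhdsWithin_le_nhds, self_mem_nhdsWithin] with w hw hw0
      have : w ^ d ≠ 0 := pow_ne_zero _ hw0
      refine mul_left_cancel₀ this ?_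
      simp only [eval_mul, eval_pow, eval_X] at hw
      rw [hw]
      ring
    have h2 : Filter.Tendsto (fun w => r.eval w) (𝓝[≠] (0 : ℂ)) (𝓝 (r.eval 0)) :=
      r.continuous.continuousAt.tendsto.mono_left nhdsWithin_le_nhds
    have h3 : Filter.Tendsto (fun w => w * g w) (𝓝[≠] (0 : ℂ)) (𝓝 (0 * g 0)) :=
      (continuousAt_id.mul hg).tendsto.mono_left nhdsWithin_le_nhds
    rw [zero_mul] at h3
    exact tendsto_nhds_unique (h2.congr' h1) h3

theorem norm_lt_of_pow_eq_sum {d : ℕ} {c : ℕ → ℂ} {δ ε : ℝ} (hδ : 0 < δ) (hδ1 : δ ≤ 1)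
    (hε : d * ε < δ ^ d) (hc : ∀ j < d, ‖c j‖ ≤ ε) {ζ : ℂ}
    (h : ζ ^ d = ∑ j ∈ Finset.range d, c j * ζ ^ j) : ‖ζ‖ < δ := by
  by_contra! hζ
  have hζ0 : 0 < ‖ζ‖ ^ d := pow_pos (hδ.trans_le hζ) d
  have hδ0 : 0 < δ ^ d := pow_pos hδ d
  have h1 : ∀ j ∈ Finset.range d, ‖c j * ζ ^ j‖ * δ ^ d ≤ ε * ‖ζ‖ ^ d := by
    intro j hj
    have hj' := Finset.mem_range.1 hj
    have hε0 : 0 ≤ ε := (norm_nonneg _).trans (hc j hj')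
    have h2 : ‖ζ‖ ^ j * δ ^ d ≤ ‖ζ‖ ^ d := by
      calc ‖ζ‖ ^ j * δ ^ d = ‖ζ‖ ^ j * (δ ^ (d - j) * δ ^ j) := by
            rw [← pow_add, Nat.sub_add_cancel hj'.le]
        _ ≤ ‖ζ‖ ^ j * (‖ζ‖ ^ (d - j) * 1) := by
            gcongr
            exact pow_le_one₀ hδ.le hδ1
        _ = ‖ζ‖ ^ d := by
            rw [mul_one, ← pow_add, Nat.add_sub_cancel' hj'.le]
    rw [norm_mul, norm_pow, mul_assoc]
    exact mul_le_mul (hc j hj') h2 (by positivity) hε0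
  have h2 : ‖ζ‖ ^ d * δ ^ d ≤ d * (ε * ‖ζ‖ ^ d) := by
    calc ‖ζ‖ ^ d * δ ^ d ≤ (∑ j ∈ Finset.range d, ‖c j * ζ ^ j‖) * δ ^ d := by
          rw [← norm_pow, h]
          gcongr
          exact norm_sum_le _ _
      _ ≤ ∑ j ∈ Finset.range d, ε * ‖ζ‖ ^ d := by
          rw [Finset.sum_mul]
          exact Finset.sum_le_sum h1
      _ = _ := by simp
  nlinarith

theorem Polynomial.exists_common_root_of_resultant_eq_zero {P : ℂ[X]} (hP : P.Monic) {m : ℕ}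
    {r : Fin m → ℂ[X]} (hr : ∀ j, (r j).natDegree ≤ P.natDegree + 1)
    (h : ∀ t ∈ Finset.range (P.natDegree * m + 1),
      resultant P (∑ j : Fin m, C ((t : ℂ) ^ (j : ℕ)) * r j) P.natDegree (P.natDegree + 1) = 0) :
    ∃ ζ, P.eval ζ = 0 ∧ ∀ j, (r j).eval ζ = 0 := by
  classical
  have key : ∀ t ∈ Finset.range (P.natDegree * m + 1), ∃ ζ ∈ P.roots.toFinset,
      (∑ j : Fin m, C ((r j).eval ζ) * X ^ (j : ℕ)).eval (t : ℂ) = 0 := by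
    intro t ht
    have h1 := h t ht
    rw [resultant_eq_prod_eval _ _ _ ?_ (IsAlgClosed.splits P), hP.leadingCoeff, one_pow, one_mul,
      Multiset.prod_eq_zero_iff, Multiset.mem_map] at h1
    · obtain ⟨ζ, hζ, h2⟩ := h1
      refine ⟨ζ, by simpa using hζ, ?_⟩
      rw [← h2]
      simp only [eval_finsetSum, eval_mul, eval_C, eval_pow, eval_X]
      exact Finset.sum_congr rfl fun j _ => mul_comm _ _
    · exact natDegree_sum_le_of_forall_le _ _ fun j _ => (natDegree_C_mul_le _ _).trans (hr j)
  choose! root hroot hroot' using key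
  obtain ⟨ζ, hζ, hcard⟩ := Finset.exists_lt_card_fiber_of_mul_lt_card_of_maps_to (n := m) hroot (by
    rw [Finset.card_range, Nat.lt_succ_iff]
    exact Nat.mul_le_mul_right m ((Multiset.toFinset_card_le _).trans (card_roots' P)))
  refine ⟨ζ, by simpa [hP.ne_zero] using hζ, fun j => ?_⟩
  have hzero : ∑ j : Fin m, C ((r j).eval ζ) * X ^ (j : ℕ) = 0 := by
    by_contra hne
    refine hne (eq_zero_of_natDegree_lt_card_of_eval_eq_zero'
      _ ((Finset.filter (fun t => root t = ζ) (Finset.range (P.natDegree * m + 1))).image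
        (Nat.cast : ℕ → ℂ)) ?_ ?_)
    · intro i hi
      obtain ⟨t, ht, rfl⟩ := Finset.mem_image.1 hi
      obtain ⟨ht1, ht2⟩ := Finset.mem_filter.1 ht
      have := hroot' t ht1
      rwa [ht2] at this
    · rw [Finset.card_image_of_injective _ Nat.cast_injective]
      refine lt_trans ?_ hcard
      rw [natDegree_lt_iff_degree_lt hne]
      exact degree_sum_fin_lt fun j => (r j).eval ζ
  have := congrArg (fun p => p.coeff (j : ℕ)) hzero
  simpa [finsetSum_coeff, coeff_C_mul, coeff_X_pow, Fin.val_inj] using this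

end Elimination

section Nullstellensatz

open Polynomial

/-- The ring of complex functions which are analytic at the origin. -/
def analyticRing (E : Type*) [NormedAddCommGroup E] [NormedSpace ℂ E] : Subalgebra ℂ (E → ℂ) where
  carrier := {f | AnalyticAt ℂ f 0}
  add_mem' := AnalyticAt.add
  mul_mem' := AnalyticAt.mul
  algebraMap_mem' := fun _ => analyticAt_const

variable {E F : Type*} [NormedAddCommGroup E] [NormedSpace ℂ E]
  [NormedAddCommGroup F] [NormedSpace ℂ F]

theorem analyticAt_analyticRing (f : analyticRing E) : AnalyticAt ℂ f.1 0 := f.2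

/-- The ideal of functions vanishing near the origin. -/
def eventuallyZeroIdeal (E : Type*) [NormedAddCommGroup E] [NormedSpace ℂ E] :
    Ideal (analyticRing E) where
  carrier := {f | ∀ᶠ z in 𝓝 (0 : E), f.1 z = 0}
  add_mem' := by
    intro a b ha hb
    filter_upwards [ha, hb] with z h1 h2
    simp [h1, h2]
  zero_mem' := Filter.Eventually.of_forall fun _ => rfl
  smul_mem' := by
    intro c a ha
    filter_upwards [ha] with z h1
    simp [h1]

theorem Ideal.mem_of_eventuallyEq {I : Ideal (analyticRing E)} (hI : eventuallyZeroIdeal E ≤ I)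
    {f g : analyticRing E} (hf : f ∈ I) (h : ∀ᶠ z in 𝓝 (0 : E), g.1 z = f.1 z) : g ∈ I := by
  have h1 : g - f ∈ eventuallyZeroIdeal E := by
    filter_upwards [h] with z hz
    simp [hz]
  simpa using I.add_mem (hI h1) hf

/-- Composition with a continuous linear map. -/
def analyticRingComp (e : E →L[ℂ] F) : analyticRing F →+* analyticRing E where
  toFun g := ⟨g.1 ∘ e, AnalyticAt.comp_of_eq g.2 (e.analyticAt 0) (map_zero e)⟩
  map_one' := rfl
  map_mul' _ _ := rfl
  map_zero' := rfl
  map_add' _ _ := rfl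

theorem analyticRingComp_apply (e : E →L[ℂ] F) (g : analyticRing F) (z : E) :
    (analyticRingComp e g).1 z = g.1 (e z) := rfl

/-- Evaluation at a point. -/
def analyticRingEval (z : E) : analyticRing E →+* ℂ :=
  (Pi.evalRingHom (fun _ : E => ℂ) z).comp (analyticRing E).val.toRingHom

theorem analyticRingEval_apply (z : E) (g : analyticRing E) : analyticRingEval z g = g.1 z := rfl

/-- The first coordinate function on `ℂ × E`. -/
def analyticRingFst (E : Type*) [NormedAddCommGroup E] [NormedSpace ℂ E] : analyticRing (ℂ × E) :=
  ⟨Prod.fst, analyticAt_fst⟩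

/-- A polynomial with coefficients analytic on `E`, as a function on `ℂ × E`. -/
def polynomialToAnalytic (E : Type*) [NormedAddCommGroup E] [NormedSpace ℂ E] :
    (analyticRing E)[X] →+* analyticRing (ℂ × E) :=
  eval₂RingHom (analyticRingComp (ContinuousLinearMap.snd ℂ ℂ E)) (analyticRingFst E)

theorem polynomialToAnalytic_apply (p : (analyticRing E)[X]) (x : ℂ × E) :
    (polynomialToAnalytic E p).1 x = (p.map (analyticRingEval x.2)).eval x.1 := by
  rw [← analyticRingEval_apply, polynomialToAnalytic, coe_eval₂RingHom, hom_eval₂, eval_map]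
  rfl

/-- The Nullstellensatz for ideals with zero locus reduced to the origin. -/
def HasIsolatedNullstellensatz (E : Type*) [NormedAddCommGroup E] [NormedSpace ℂ E] : Prop :=
  ∀ I : Ideal (analyticRing E), eventuallyZeroIdeal E ≤ I → ∀ (m : ℕ) (s : Fin m → analyticRing E),
    (∀ j, s j ∈ I) → (∀ᶠ z in 𝓝 (0 : E), (∀ j, (s j).1 z = 0) → z = 0) →
    ∀ f : analyticRing E, f.1 0 = 0 → f ∈ I.radical

theorem exists_mem_eq_pow {I : Ideal (analyticRing (ℂ × E))} {s : analyticRing (ℂ × E)}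
    (hs : s ∈ I) (hne : ¬ ∀ᶠ w in 𝓝 (0 : ℂ), s.1 (w, 0) = 0) :
    ∃ a ∈ I, ∃ d : ℕ, ∀ᶠ w in 𝓝 (0 : ℂ), a.1 (w, 0) = w ^ d := by
  have h1 : AnalyticAt ℂ (fun w : ℂ => s.1 (w, 0)) 0 :=
    AnalyticAt.comp_of_eq s.2 (analyticAt_id.prod analyticAt_const) rfl
  obtain ⟨d, u, hu, hu0, hd⟩ := h1.exists_eventuallyEq_pow_smul_nonzero_iff.2 hne
  let v : analyticRing (ℂ × E) := ⟨fun x => (u x.1)⁻¹,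
    AnalyticAt.comp_of_eq (g := u⁻¹) (f := Prod.fst) (hu.inv hu0) analyticAt_fst rfl⟩
  refine ⟨v * s, I.mul_mem_left _ hs, d, ?_⟩
  filter_upwards [hd, hu.continuousAt.eventually_ne hu0] with w hw hw0
  change (u w)⁻¹ * s.1 (w, 0) = _
  rw [hw, sub_zero, smul_eq_mul]
  field_simp

theorem exists_division {a : analyticRing (ℂ × E)} {d : ℕ}
    (had : ∀ᶠ w in 𝓝 (0 : ℂ), a.1 (w, 0) = w ^ d) (b : analyticRing (ℂ × E)) :
    ∃ q : analyticRing (ℂ × E), ∃ c : ℕ → analyticRing E, ∀ᶠ x in 𝓝 (0 : ℂ × E),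
      b.1 x = q.1 x * a.1 x + ∑ j ∈ Finset.range d, (c j).1 x.2 * x.1 ^ j := by
  obtain ⟨q, hq, c, hc, h⟩ := weierstrass_division a.2 b.2 had
  exact ⟨⟨q, hq⟩, fun j => ⟨c j, hc j⟩, h⟩

theorem mem_radical_of_fst_mem_radical {I : Ideal (analyticRing (ℂ × E))}
    (hI : eventuallyZeroIdeal (ℂ × E) ≤ I) (hw : analyticRingFst E ∈ I.radical)
    (h : ∀ g : analyticRing E, g.1 0 = 0 →
      analyticRingComp (ContinuousLinearMap.snd ℂ ℂ E) g ∈ I.radical)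
    {f : analyticRing (ℂ × E)} (hf : f.1 0 = 0) : f ∈ I.radical := by
  obtain ⟨q, c, hqc⟩ := exists_division (a := analyticRingFst E) (d := 1)
    (Filter.Eventually.of_forall fun w => (pow_one w).symm) f
  refine Ideal.mem_of_eventuallyEq (hI.trans Ideal.le_radical) (f := q * analyticRingFst E +
    analyticRingComp (ContinuousLinearMap.snd ℂ ℂ E) (c 0))
    (add_mem (Ideal.mul_mem_left _ _ hw) (h _ ?_)) ?_
  · have := hqc.self_of_nhds
    simpa [hf, analyticRingFst] using this.symm
  · filter_upwards [hqc] with x hx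
    rw [hx]
    simp [analyticRingComp_apply]

theorem polynomialToAnalytic_sum_apply (c : ℕ → analyticRing E) (d : ℕ) (x : ℂ × E) :
    (polynomialToAnalytic E (∑ j : Fin d, C (c j) * X ^ (j : ℕ))).1 x
      = ∑ j ∈ Finset.range d, (c j).1 x.2 * x.1 ^ j := by
  rw [polynomialToAnalytic_apply, Polynomial.map_sum, eval_finsetSum, Finset.sum_range]
  simp [analyticRingEval_apply]

theorem HasIsolatedNullstellensatz.prod (hE : HasIsolatedNullstellensatz E)
    {I : Ideal (analyticRing (ℂ × E))} (hI : eventuallyZeroIdeal (ℂ × E) ≤ I) {m : ℕ}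
    {s : Fin m → analyticRing (ℂ × E)} (hs : ∀ j, s j ∈ I)
    (hs0 : ∀ᶠ x in 𝓝 (0 : ℂ × E), (∀ j, (s j).1 x = 0) → x = 0) {j₀ : Fin m}
    (hne : ¬ ∀ᶠ w in 𝓝 (0 : ℂ), (s j₀).1 (w, 0) = 0)
    {f : analyticRing (ℂ × E)} (hf : f.1 0 = 0) : f ∈ I.radical := by
  obtain ⟨a, ha, d, had⟩ := exists_mem_eq_pow (hs j₀) hne
  obtain ⟨q, c, hqc⟩ := exists_division had (analyticRingFst E ^ d)
  choose q' c' hqc' using fun j => exists_division had (s j)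
  set P : (analyticRing E)[X] := X ^ d - ∑ j : Fin d, C (c j) * X ^ (j : ℕ) with hPdef
  let r : Fin m → (analyticRing E)[X] := fun j => ∑ k : Fin d, C (c' j k) * X ^ (k : ℕ)
  have hPm : P.Monic := monic_X_pow_sub (degree_sum_fin_lt _)
  have hPd : P.natDegree = d := by
    refine natDegree_eq_of_degree_eq_some ?_
    rw [hPdef, degree_sub_eq_left_of_degree_lt, degree_X_pow]
    rw [degree_X_pow]
    exact degree_sum_fin_lt _
  have hPx : ∀ x : ℂ × E, (polynomialToAnalytic E P).1 x
      = x.1 ^ d - ∑ j ∈ Finset.range d, (c j).1 x.2 * x.1 ^ j := by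
    intro x
    rw [polynomialToAnalytic_apply, hPdef, Polynomial.map_sub, eval_sub,
      ← polynomialToAnalytic_sum_apply, polynomialToAnalytic_apply]
    simp
  have hPq : ∀ᶠ x in 𝓝 (0 : ℂ × E), (polynomialToAnalytic E P).1 x = q.1 x * a.1 x := by
    filter_upwards [hqc] with x hx
    rw [hPx, sub_eq_iff_eq_add, ← hx]
    rfl
  have hPI : polynomialToAnalytic E P ∈ I :=
    Ideal.mem_of_eventuallyEq hI (I.mul_mem_left q ha) hPq
  have hrI : ∀ j, polynomialToAnalytic E (r j) ∈ I := by
    intro j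
    refine Ideal.mem_of_eventuallyEq hI (I.sub_mem (hs j) (I.mul_mem_left (q' j) ha)) ?_
    filter_upwards [hqc' j] with x hx
    rw [polynomialToAnalytic_sum_apply]
    simp [hx]
  have hslice : Filter.Tendsto (fun w : ℂ => ((w, 0) : ℂ × E)) (𝓝 0) (𝓝 0) :=
    (Continuous.prodMk_left (0 : E)).tendsto' _ _ rfl
  have hqslice : ContinuousAt (fun w : ℂ => q.1 (w, 0)) 0 :=
    ContinuousAt.comp_of_eq (AnalyticAt.continuousAt q.2) (by fun_prop) rfl
  have hP0 : P.map (analyticRingEval (0 : E)) = X ^ d := by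
    have h1 : X ^ d ∣ P.map (analyticRingEval (0 : E)) := by
      refine X_pow_dvd_of_eventually_eval_eq hqslice ?_
      filter_upwards [hslice.eventually hPq, had] with w hw hw'
      rw [polynomialToAnalytic_apply, hw'] at hw
      rw [hw, mul_comm]
    refine (eq_of_monic_of_dvd_of_natDegree_le (monic_X_pow d) (hPm.map _) h1 ?_)
    rw [hPm.natDegree_map, hPd, natDegree_X_pow]
  have hc0 : ∀ j < d, (c j).1 0 = 0 := by
    intro j hj
    have h1 := congrArg (fun p => p.coeff j) hP0
    simp only [hPdef, Polynomial.map_sub, Polynomial.map_pow, map_X, Polynomial.map_sum,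
      Polynomial.map_mul, map_C, coeff_sub, finsetSum_coeff, coeff_C_mul, coeff_X_pow] at h1
    rw [Finset.sum_eq_single ⟨j, hj⟩ (fun k _ hk => by simp [Fin.ext_iff] at hk ⊢; grind)
      (by simp)] at h1
    simpa [analyticRingEval_apply] using h1
  have hq0 : q.1 0 ≠ 0 := by
    have h1 : ∀ᶠ w in 𝓝[≠] (0 : ℂ), q.1 (w, 0) = 1 := by
      filter_upwards [(hslice.eventually hPq).filter_mono nhdsWithin_le_nhds,
        had.filter_mono nhdsWithin_le_nhds, self_mem_nhdsWithin] with w hw hw' hw0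
      rw [polynomialToAnalytic_apply, hP0, hw', eval_pow, eval_X] at hw
      exact mul_right_cancel₀ (pow_ne_zero d hw0) (hw.symm.trans (one_mul _).symm)
    have h2 := tendsto_nhds_unique (hqslice.tendsto.mono_left nhdsWithin_le_nhds)
      (tendsto_const_nhds.congr' (h1.mono fun _ h => h.symm))
    exact h2 ▸ one_ne_zero
  let N : Fin (d * m + 1) → analyticRing E := fun t =>
    resultant P (∑ j : Fin m, C (((t : ℕ) : analyticRing E) ^ (j : ℕ)) * r j) d (d + 1)
  have hrd : ∀ j, (r j).natDegree ≤ d + 1 := fun j =>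
    (natDegree_le_of_degree_le (degree_sum_fin_lt _).le).trans d.le_succ
  let π := analyticRingComp (ContinuousLinearMap.snd ℂ ℂ E)
  have hNI : ∀ t, N t ∈ I.comap π := by
    intro t
    obtain ⟨u, v, -, -, huv⟩ := exists_mul_add_mul_eq_C_resultant (m := d) (n := d + 1) P
      (∑ j : Fin m, C (((t : ℕ) : analyticRing E) ^ (j : ℕ)) * r j) hPd.le
      (natDegree_sum_le_of_forall_le _ _ fun j _ => (natDegree_C_mul_le _ _).trans (hrd j))
      (Or.inr d.succ_ne_zero)
    have h1 : polynomialToAnalytic E (C (N t)) = π (N t) := eval₂_C _ _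
    rw [Ideal.mem_comap, ← h1, ← huv, RingHom.map_add, RingHom.map_mul, RingHom.map_mul]
    refine I.add_mem (I.mul_mem_right _ hPI) (I.mul_mem_right _ ?_)
    rw [map_sum]
    refine I.sum_mem fun j _ => ?_
    rw [RingHom.map_mul]
    exact I.mul_mem_left _ (hrI j)
  have hN0 : ∀ᶠ z in 𝓝 (0 : E), (∀ t, (N t).1 z = 0) → z = 0 := by
    obtain ⟨δ₀, hδ₀, hδ⟩ := Metric.eventually_nhds_iff.1 (hs0.and ((Filter.eventually_all.2 hqc').and
      (hPq.and ((AnalyticAt.continuousAt q.2).eventually_ne hq0))))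
    obtain ⟨δ, hδ0, hδδ₀, hδ1⟩ : ∃ δ : ℝ, 0 < δ ∧ δ ≤ δ₀ ∧ δ ≤ 1 :=
      ⟨min δ₀ 1, by positivity, by simp, by simp⟩
    obtain ⟨ε, hε0, hε⟩ : ∃ ε : ℝ, 0 < ε ∧ d * ε < δ ^ d := by
      refine ⟨δ ^ d / (d + 1), by positivity, ?_⟩
      rw [← mul_div_assoc, div_lt_iff₀ (by positivity)]
      nlinarith [pow_pos hδ0 d]
    have hcε : ∀ᶠ z in 𝓝 (0 : E), ∀ j ∈ Finset.range d, ‖(c j).1 z‖ < ε := by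
      rw [Filter.eventually_all_finset]
      intro j hj
      have h1 : ContinuousAt (fun z => ‖(c j).1 z‖) 0 :=
        (AnalyticAt.continuousAt (c j).2).norm
      refine h1.eventually_lt continuousAt_const ?_
      simpa [hc0 j (Finset.mem_range.1 hj)] using hε0
    filter_upwards [hcε, Metric.ball_mem_nhds 0 hδ0] with z hz hzδ hNz
    have hPz : (P.map (analyticRingEval z)).natDegree = d := by rw [hPm.natDegree_map, hPd]
    obtain ⟨ζ, hζ, hrζ⟩ := exists_common_root_of_resultant_eq_zero (hPm.map (analyticRingEval z))
      (r := fun j => (r j).map (analyticRingEval z)) (m := m)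
      (fun j => by rw [hPz]; exact natDegree_map_le.trans (hrd j)) (fun t ht => by
        rw [hPz] at ht ⊢
        have h1 := hNz ⟨t, Finset.mem_range.1 ht⟩
        rw [← analyticRingEval_apply, ← resultant_map_map] at h1
        have h2 : (∑ j : Fin m, C (((t : ℕ) : analyticRing E) ^ (j : ℕ)) * r j).map
            (analyticRingEval z) = ∑ j : Fin m, C ((t : ℂ) ^ (j : ℕ)) *
              (r j).map (analyticRingEval z) := by
          rw [Polynomial.map_sum]
          simp only [Polynomial.map_mul, map_pow, map_natCast, Polynomial.map_pow, Polynomial.map_natCast]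
        exact (congrArg (fun b => resultant _ b d (d + 1)) h2).symm.trans h1)
    have hPζ : (polynomialToAnalytic E P).1 (ζ, z) = 0 := by
      rw [polynomialToAnalytic_apply]
      exact hζ
    have hζδ : ‖ζ‖ < δ := by
      refine norm_lt_of_pow_eq_sum hδ0 hδ1 hε (c := fun j => (c j).1 z)
        (fun j hj => (hz j (Finset.mem_range.2 hj)).le) ?_
      rw [hPx, sub_eq_zero] at hPζ
      exact hPζ
    have hdist : dist (ζ, z) (0 : ℂ × E) < δ₀ := by
      rw [dist_zero_right, Prod.norm_def]
      exact (max_lt hζδ (by simpa using hzδ)).trans_le hδδ₀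
    obtain ⟨h1, h2, h3, h4⟩ := hδ hdist
    have haζ : a.1 (ζ, z) = 0 := by
      rw [hPζ] at h3
      exact (mul_eq_zero.1 h3.symm).resolve_left h4
    refine congrArg Prod.snd (h1 fun j => ?_)
    rw [h2 j, haζ, mul_zero, zero_add, ← polynomialToAnalytic_sum_apply,
      polynomialToAnalytic_apply]
    exact hrζ j
  have hπ : ∀ g : analyticRing E, g.1 0 = 0 → π g ∈ I.radical := by
    intro g hg
    have h1 : eventuallyZeroIdeal E ≤ I.comap π := by
      intro g hg
      refine hI ?_
      have h2 : Filter.Tendsto (Prod.snd : ℂ × E → E) (𝓝 0) (𝓝 0) := continuous_snd.tendsto' _ _ rfl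
      exact h2.eventually hg
    have h2 := hE (I.comap π) h1 _ N hNI hN0 g hg
    rwa [← Ideal.comap_radical] at h2
  refine mem_radical_of_fst_mem_radical hI ?_ hπ hf
  refine (I.radical_isRadical) ⟨d, ?_⟩
  refine Ideal.mem_of_eventuallyEq (hI.trans Ideal.le_radical) (f := q * a +
    ∑ j ∈ Finset.range d, π (c j) * analyticRingFst E ^ j) ?_ ?_
  · refine add_mem (Ideal.le_radical (I.mul_mem_left _ ha)) (sum_mem fun j hj => ?_)
    exact Ideal.mul_mem_right _ _ (hπ _ (hc0 j (Finset.mem_range.1 hj)))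
  · filter_upwards [hqc] with x hx
    rw [hx]
    simp [π, analyticRingFst, analyticRingComp_apply]

end Nullstellensatz

section Nullstellensatz

variable {E F : Type*} [NormedAddCommGroup E] [NormedSpace ℂ E]
  [NormedAddCommGroup F] [NormedSpace ℂ F]

theorem exists_not_eventually_zero_on_line [Nontrivial E] {m : ℕ} {s : Fin m → analyticRing E}
    (hs0 : ∀ᶠ z in 𝓝 (0 : E), (∀ j, (s j).1 z = 0) → z = 0) :
    ∃ v : E, v ≠ 0 ∧ ∃ j, ¬ ∀ᶠ w in 𝓝 (0 : ℂ), (s j).1 (w • v) = 0 := by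
  have h1 : ∀ᶠ z in 𝓝 (0 : E), ∀ j, AnalyticAt ℂ (s j).1 z :=
    Filter.eventually_all.2 fun j => (analyticAt_analyticRing (s j)).eventually_analyticAt
  obtain ⟨ρ, hρ, hρs⟩ := Metric.eventually_nhds_iff_ball.1 h1
  have : Filter.NeBot (𝓝[≠] (0 : E)) := Module.punctured_nhds_neBot ℂ E 0
  have h0 : ∀ᶠ z in 𝓝[≠] (0 : E), z ≠ 0 := self_mem_nhdsWithin
  obtain ⟨v, hv, h2, hvρ⟩ :=
    (h0.and ((hs0.and (Metric.ball_mem_nhds 0 hρ)).filter_mono nhdsWithin_le_nhds)).exists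
  refine ⟨v, hv, ?_⟩
  by_contra! hall
  refine hv (h2 fun j => ?_)
  have hU : Convex ℝ ((fun w : ℂ => w • v) ⁻¹' Metric.ball 0 ρ) :=
    (convex_ball (0 : E) ρ).is_linear_preimage
      ⟨fun x y => add_smul x y v, fun c x => smul_assoc c x v⟩
  have h3 : AnalyticOnNhd ℂ (fun w : ℂ => (s j).1 (w • v))
      ((fun w : ℂ => w • v) ⁻¹' Metric.ball 0 ρ) := fun w hw =>
    AnalyticAt.comp_of_eq (hρs _ hw j) (analyticAt_id.smul analyticAt_const) rfl
  have h4 := h3.eqOn_zero_of_preconnected_of_eventuallyEq_zero hU.isPreconnected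
    (z₀ := 0) (by simpa) (hall j)
  have h5 := h4 (show (1 : ℂ) ∈ _ by simpa using hvρ)
  simpa using h5

theorem HasIsolatedNullstellensatz.of_mem_comap (e : E ≃L[ℂ] F) {I : Ideal (analyticRing E)}
    {f : analyticRing E}
    (h : analyticRingComp (e.symm : F →L[ℂ] E) f ∈ (I.comap (analyticRingComp (e : E →L[ℂ] F))).radical) :
    f ∈ I.radical := by
  rw [← Ideal.comap_radical, Ideal.mem_comap] at h
  convert h using 1
  ext z
  simp [analyticRingComp_apply]

theorem hasIsolatedNullstellensatz (E : Type*) [NormedAddCommGroup E] [NormedSpace ℂ E]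
    [FiniteDimensional ℂ E] : HasIsolatedNullstellensatz E := by
  induction hn : Module.finrank ℂ E generalizing E with
  | zero =>
    intro I _ m s _ _ f hf
    have := Module.finrank_zero_iff.1 hn
    have h0 : f = 0 := by
      ext z
      rw [Subsingleton.elim z 0, hf]
      rfl
    rw [h0]
    exact zero_mem _
  | succ n ih =>
    intro I hI m s hs hs0 f hf
    have : Nontrivial E := Module.nontrivial_of_finrank_pos (R := ℂ) (by omega)
    obtain ⟨v, hv, j, hj⟩ := exists_not_eventually_zero_on_line hs0
    obtain ⟨φ, hφ⟩ := SeparatingDual.exists_eq_one (R := ℂ) hv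
    let e : E ≃L[ℂ] ℂ × φ.ker := ContinuousLinearEquiv.equivOfRightInverse φ
      (ContinuousLinearMap.toSpanSingleton ℂ v) (fun w => by simp [hφ])
    have he : ∀ w : ℂ, e.symm (w, 0) = w • v := by
      intro w
      simp [e]
    have hK : Module.finrank ℂ φ.ker = n := by
      have h1 := e.toLinearEquiv.finrank_eq
      rw [Module.finrank_prod, Module.finrank_self] at h1
      omega
    have hcomp : ∀ g : analyticRing E, analyticRingComp (e : E →L[ℂ] ℂ × φ.ker)
        (analyticRingComp (e.symm : (ℂ × φ.ker) →L[ℂ] E) g) = g := by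
      intro g
      ext z
      simp [analyticRingComp_apply]
    refine HasIsolatedNullstellensatz.of_mem_comap e ((ih φ.ker hK).prod ?_
      (s := fun j => analyticRingComp (e.symm : (ℂ × φ.ker) →L[ℂ] E) (s j)) (fun j => ?_) ?_ (j₀ := j) ?_ ?_)
    · intro g hg
      refine hI ?_
      exact (e.continuous.tendsto' 0 0 (map_zero e)).eventually hg
    · rw [Ideal.mem_comap, hcomp]
      exact hs j
    · have h1 := (e.symm.continuous.tendsto' 0 0 (map_zero e.symm)).eventually hs0
      filter_upwards [h1] with x hx hx0
      simpa using hx hx0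
    · simpa only [analyticRingComp_apply, ContinuousLinearEquiv.coe_coe, he] using hj
    · rw [analyticRingComp_apply]
      simpa using hf

end Nullstellensatz

section Order

/-- The power series obtained by deleting the terms of degree less than `N`. -/
def FormalMultilinearSeries.tail {E F : Type*} [NormedAddCommGroup E] [NormedSpace ℂ E]
    [NormedAddCommGroup F] [NormedSpace ℂ F] (p : FormalMultilinearSeries ℂ E F) (N : ℕ) :
    FormalMultilinearSeries ℂ E F :=
  fun j => if j < N then 0 else p j

theorem HasFPowerSeriesAt.tail {E F : Type*} [NormedAddCommGroup E] [NormedSpace ℂ E]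
    [NormedAddCommGroup F] [NormedSpace ℂ F] {f : E → F} {p : FormalMultilinearSeries ℂ E F}
    (h : HasFPowerSeriesAt f p 0) (N : ℕ) :
    HasFPowerSeriesAt (fun z => f z - ∑ j ∈ Finset.range N, p j fun _ => z) (p.tail N) 0 := by
  obtain ⟨r, hr⟩ := h
  refine ⟨r, hr.r_le.trans (FormalMultilinearSeries.radius_le_of_le fun j => ?_), hr.r_pos, ?_⟩
  · unfold FormalMultilinearSeries.tail
    split_ifs <;> simp
  · intro y hy
    have h1 := hr.hasSum hy
    have h2 : HasSum (fun j => if j < N then p j fun _ => y else 0)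
        (∑ j ∈ Finset.range N, if j < N then p j fun _ => y else 0) :=
      hasSum_sum_of_ne_finset_zero fun j hj => if_neg (by simpa using hj)
    rw [Finset.sum_congr rfl fun j hj => if_pos (Finset.mem_range.1 hj)] at h2
    rw [zero_add] at h1 ⊢
    refine (h1.sub h2).congr_fun ?_
    intro j
    unfold FormalMultilinearSeries.tail
    split_ifs <;> simp

variable {n : ℕ}

/-- The coordinate functions on `ℂⁿ`. -/
def analyticCoordinate (i : Fin n) : analyticRing (EuclideanSpace ℂ (Fin n)) :=
  ⟨fun z => z i, (EuclideanSpace.proj (𝕜 := ℂ) i).analyticAt 0⟩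

/-- The ideal generated by the coordinate functions. -/
def coordinateIdeal (n : ℕ) : Ideal (analyticRing (EuclideanSpace ℂ (Fin n))) :=
  Ideal.span (Set.range analyticCoordinate)

theorem apply_zero_of_mem_coordinateIdeal {h : analyticRing (EuclideanSpace ℂ (Fin n))}
    (hh : h ∈ coordinateIdeal n) : h.1 0 = 0 := by
  have h1 : coordinateIdeal n ≤ RingHom.ker (analyticRingEval (0 : EuclideanSpace ℂ (Fin n))) := by
    rw [coordinateIdeal, Ideal.span_le]
    rintro _ ⟨i, rfl⟩
    rfl
  exact h1 hh

theorem mem_coordinateIdeal_pow_sup (N : ℕ) :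
    ∀ (p : FormalMultilinearSeries ℂ (EuclideanSpace ℂ (Fin n)) ℂ)
      (h : analyticRing (EuclideanSpace ℂ (Fin n))), HasFPowerSeriesAt h.1 p 0 →
      (∀ j < N, p j = 0) → h ∈ coordinateIdeal n ^ N ⊔ eventuallyZeroIdeal _ := by
  induction N with
  | zero => simp
  | succ N ih =>
    intro p h hp hpj
    have hQ : HasFPowerSeriesAt p.shift.sum p.shift 0 := by
      refine (p.shift.hasFPowerSeriesOnBall ?_).hasFPowerSeriesAt
      rw [FormalMultilinearSeries.radius_shift]
      exact hp.radius_pos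
    have hhQ : ∀ᶠ z in 𝓝 0, h.1 z = p.shift.sum z z := by
      obtain ⟨r, hr⟩ := hp
      obtain ⟨r', hr'⟩ := hQ
      have h1 : HasFPowerSeriesAt h.1 p 0 := ⟨r, hr⟩
      filter_upwards [h1.eventually_hasSum, hr'.hasFPowerSeriesAt.eventually_hasSum] with z hz hz'
      rw [zero_add] at hz hz'
      have h2 := hz'.mapL (ContinuousLinearMap.apply ℂ ℂ z)
      rw [← hasSum_nat_add_iff' 1] at hz
      simp only [Finset.range_one, Finset.sum_singleton, hpj 0 N.succ_pos, sub_zero,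
        zero_apply] at hz
      refine hz.unique ((Eq.to_iff ?_).1 h2)
      congr 1
      ext j
      change p (j + 1) (Fin.snoc (fun _ : Fin j => z) z) = _
      congr 1
      ext k
      simp [Fin.snoc]
    let q : Fin n → analyticRing (EuclideanSpace ℂ (Fin n)) := fun i =>
      ⟨fun z => p.shift.sum z (EuclideanSpace.single i 1),
        AnalyticAt.continuousLinearMap_apply hQ.analyticAt analyticAt_const⟩
    have hq : ∀ i, q i ∈ coordinateIdeal n ^ N ⊔ eventuallyZeroIdeal _ := by
      intro i
      obtain ⟨r, hr⟩ := hQ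
      refine ih _ (q i) (((ContinuousLinearMap.apply ℂ ℂ
        (EuclideanSpace.single i (1 : ℂ))).comp_hasFPowerSeriesOnBall hr).hasFPowerSeriesAt) ?_
      intro j hj
      ext v
      change p (j + 1) _ = 0
      rw [hpj _ (by omega)]
      rfl
    refine Ideal.mem_of_eventuallyEq le_sup_right
      (f := ∑ i, analyticCoordinate i * q i) (sum_mem fun i _ => ?_) ?_
    · have h1 := Ideal.mul_mem_mul
        (show analyticCoordinate i ∈ coordinateIdeal n from
          Ideal.subset_span (Set.mem_range_self i)) (hq i)
      rw [Ideal.mul_sup, ← pow_succ'] at h1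
      exact (sup_le_sup_left Ideal.mul_le_right _ : _ ≤ _ ⊔ eventuallyZeroIdeal _) h1
    · filter_upwards [hhQ] with z hz
      rw [hz]
      have h1 := congrArg (p.shift.sum z) ((EuclideanSpace.basisFun (Fin n) ℂ).sum_repr z)
      rw [map_sum] at h1
      simpa [q, analyticCoordinate] using h1.symm

/-- A function vanishing to sufficiently high order lies in `𝔪 ⟨a₁, …, aₘ⟩²` if the origin is an
isolated common zero of the `aᵢ`. -/
theorem exists_order_forall_eq_sum (a : Fin n → analyticRing (EuclideanSpace ℂ (Fin n)))
    (ha : ∀ᶠ z in 𝓝 0, (∀ i, (a i).1 z = 0) → z = 0) :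
    ∃ N : ℕ, 0 < N ∧ ∀ (p : FormalMultilinearSeries ℂ (EuclideanSpace ℂ (Fin n)) ℂ)
      (h : EuclideanSpace ℂ (Fin n) → ℂ), HasFPowerSeriesAt h p 0 → (∀ j < N + 1, p j = 0) →
      ∃ H : Fin n → Fin n → EuclideanSpace ℂ (Fin n) → ℂ,
        (∀ i j, AnalyticAt ℂ (H i j) 0 ∧ H i j 0 = 0) ∧
        ∀ᶠ z in 𝓝 0, h z = ∑ i, ∑ j, H i j z * (a i).1 z * (a j).1 z := by
  set A := Ideal.span (Set.range a)
  set Z := eventuallyZeroIdeal (EuclideanSpace ℂ (Fin n))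
  have h1 : coordinateIdeal n ≤ (A ⊔ Z).radical := by
    rw [coordinateIdeal, Ideal.span_le]
    rintro _ ⟨i, rfl⟩
    exact hasIsolatedNullstellensatz _ _ le_sup_right n a
      (fun j => le_sup_left (a := A) (Ideal.subset_span (Set.mem_range_self j))) ha _ rfl
  obtain ⟨k, hk⟩ := Ideal.exists_pow_le_of_le_radical_of_fg h1
    (Submodule.fg_span (Set.finite_range _))
  refine ⟨2 * k + 1, by omega, fun p h hp hpj => ?_⟩
  have h2 : coordinateIdeal n ^ (2 * k + 2) ≤
      coordinateIdeal n • Submodule.span _ (Set.range fun x : Fin n × Fin n => a x.1 * a x.2) ⊔ Z := by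
    have h3 : Submodule.span _ (Set.range fun x : Fin n × Fin n => a x.1 * a x.2) = A * A := by
      rw [Ideal.span_mul_span']
      congr 1
      ext x
      simp [Set.mem_mul]
    rw [h3, smul_eq_mul]
    calc coordinateIdeal n ^ (2 * k + 2)
        ≤ coordinateIdeal n * (coordinateIdeal n ^ k * coordinateIdeal n ^ k) := by
          rw [← pow_add, ← pow_succ']
          exact Ideal.pow_le_pow_right (by omega)
      _ ≤ coordinateIdeal n * ((A ⊔ Z) * (A ⊔ Z)) :=
          Ideal.mul_mono_right (Ideal.mul_mono hk hk)
      _ ≤ coordinateIdeal n * (A * A ⊔ Z) := by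
          refine Ideal.mul_mono_right ?_
          rw [Ideal.mul_sup, Ideal.sup_mul]
          exact sup_le (sup_le_sup_left Ideal.mul_le_left _) (Ideal.mul_le_right.trans le_sup_right)
      _ ≤ coordinateIdeal n * (A * A) ⊔ Z := by
          rw [Ideal.mul_sup]
          exact sup_le_sup_left Ideal.mul_le_right _
  obtain ⟨b, hb, c, hc, hbc⟩ := Submodule.mem_sup.1
    (sup_le h2 le_sup_right (mem_coordinateIdeal_pow_sup _ p ⟨h, hp.analyticAt⟩ hp hpj))
  obtain ⟨H, hH, rfl⟩ := (Submodule.mem_ideal_smul_span_iff_exists_sum _ _ _).1 hb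
  refine ⟨fun i j => (H (i, j)).1,
    fun i j => ⟨(H (i, j)).2, apply_zero_of_mem_coordinateIdeal (hH _)⟩, ?_⟩
  have hc' : ∀ᶠ z in 𝓝 0, c.1 z = 0 := hc
  filter_upwards [hc'] with z hz
  have h3 := congrArg (fun g => g.1 z) hbc
  rw [Finsupp.sum_fintype _ _ (by simp), Fintype.sum_prod_type] at h3
  simp [hz] at h3
  simp [← h3, mul_assoc]

end Order

section Tougeron

open scoped ContDiff

variable {E F : Type*} [NormedAddCommGroup E] [NormedSpace ℂ E]
  [NormedAddCommGroup F] [NormedSpace ℂ F]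

theorem AnalyticAt.exists_second_increment_eq {f : E → ℂ} (hf : AnalyticAt ℂ f 0) :
    ∃ R : E × E → E →L[ℂ] E →L[ℂ] ℂ, AnalyticAt ℂ R 0 ∧
      ∀ᶠ x in 𝓝 (0 : E × E), f (x.1 + x.2) = f x.1 + fderiv ℂ f x.1 x.2 + R x x.2 x.2 := by
  obtain ⟨G, hG, hGf, hG0⟩ := hf.exists_increment_eq
  obtain ⟨K, hK, hKG, -⟩ := hG.exists_increment_eq
  let L : E × E →L[ℂ] (E × E) × (E × E) :=
    ((ContinuousLinearMap.inl ℂ E E).comp (ContinuousLinearMap.fst ℂ E E)).prod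
      ((ContinuousLinearMap.inr ℂ E E).comp (ContinuousLinearMap.snd ℂ E E))
  refine ⟨fun x => (K (L x)).comp (ContinuousLinearMap.inr ℂ E E), ?_, ?_⟩
  · have h1 := ContinuousLinearMap.analyticAt (𝕜 := ℂ) (F := E →L[ℂ] E →L[ℂ] ℂ)
      (ContinuousLinearMap.precomp (E →L[ℂ] ℂ) (ContinuousLinearMap.inr ℂ E E)) (K (L 0))
    exact h1.comp (f := fun x => K (L x))
      (AnalyticAt.comp_of_eq hK (L.analyticAt 0) (map_zero L))
  · have h1 : Filter.Tendsto L (𝓝 0) (𝓝 0) := L.continuous.tendsto' _ _ (map_zero L)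
    have h2 : Filter.Tendsto (Prod.fst : E × E → E) (𝓝 0) (𝓝 0) := continuous_fst.tendsto' _ _ rfl
    filter_upwards [hGf, h1.eventually hKG, h2.eventually hG0] with x hx hx' hx''
    have h3 : (L x).1 + (L x).2 = x := by simp [L]
    have h4 : (L x).1 = (x.1, 0) := rfl
    have h5 : (L x).2 = (0, x.2) := rfl
    rw [h3, h4, h5, hx'', sub_eq_iff_eq_add] at hx'
    rw [hx', sub_eq_iff_eq_add] at hx
    rw [hx]
    simp
    ring

theorem AnalyticAt.exists_implicit_solution [CompleteSpace E] [CompleteSpace F] {B : E × F → F}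
    (hB : AnalyticAt ℂ B 0) (hB0 : B 0 = 0)
    (hB' : HasFDerivAt (fun y => B (0, y)) (0 : F →L[ℂ] F) 0) :
    ∃ ψ : E → F, AnalyticAt ℂ ψ 0 ∧ ψ 0 = 0 ∧ ∀ᶠ z in 𝓝 0, ψ z = B (z, ψ z) := by
  have h1 : ContDiffAt ℂ ω (fun x : E × F => x.2 - B x) 0 :=
    (analyticAt_snd.sub hB).contDiffAt
  have h2 : fderiv ℂ (fun x : E × F => x.2 - B x) 0 ∘L .inr ℂ E F = .id ℂ F := by
    have h3 : HasFDerivAt (fun y : F => y - B (0, y))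
        (fderiv ℂ (fun x : E × F => x.2 - B x) 0 ∘L .inr ℂ E F) 0 := by
      have h4 : HasFDerivAt (fun x : E × F => x.2 - B x)
        (fderiv ℂ (fun x : E × F => x.2 - B x) 0) ((ContinuousLinearMap.inr ℂ E F) 0) := by
        rw [map_zero]
        exact (h1.differentiableAt (by simp)).hasFDerivAt
      exact h4.comp 0 (ContinuousLinearMap.inr ℂ E F).hasFDerivAt
    have h5 := (hasFDerivAt_id (𝕜 := ℂ) (0 : F)).sub hB'
    rw [sub_zero] at h5
    exact h3.unique h5
  have h3 : (fderiv ℂ (fun x : E × F => x.2 - B x) 0 ∘L .inr ℂ E F).IsInvertible := by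
    rw [h2]
    exact ContinuousLinearMap.isInvertible_equiv (f := ContinuousLinearEquiv.refl ℂ F)
  refine ⟨h1.implicitFunction (by simp) h3, (h1.contDiffAt_implicitFunction (by simp) h3).analyticAt,
    h1.implicitFunction_apply_self (by simp) h3, ?_⟩
  filter_upwards [h1.eventually_apply_implicitFunction (by simp) h3] with z hz
  simpa [hB0, sub_eq_zero] using hz

theorem HasFDerivAt.mul_of_eq_zero {u w : E → ℂ} {x : E} (hu : DifferentiableAt ℂ u x)
    (hw : DifferentiableAt ℂ w x) (hu0 : u x = 0) (hw0 : w x = 0) :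
    HasFDerivAt (fun z => u z * w z) (0 : E →L[ℂ] ℂ) x := by
  refine (hu.hasFDerivAt.mul hw.hasFDerivAt).congr_fderiv ?_
  ext
  simp [hu0, hw0]

variable {n : ℕ}

theorem sum_sum_sum_sum_comm (T : Fin n → Fin n → Fin n → Fin n → ℂ) :
    ∑ k, ∑ l, ∑ j, ∑ i, T k l j i = ∑ i, ∑ j, ∑ k, ∑ l, T k l j i := by
  have h : ∑ x : Fin n × Fin n, ∑ y : Fin n × Fin n, T x.1 x.2 y.2 y.1
      = ∑ y : Fin n × Fin n, ∑ x : Fin n × Fin n, T x.1 x.2 y.2 y.1 := Finset.sum_comm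
  simp only [Fintype.sum_prod_type] at h
  rw [← h]
  exact Finset.sum_congr rfl fun k _ => Finset.sum_congr rfl fun l _ => Finset.sum_comm

/-- If `g - f` lies in `𝔪 J²`, where `J` is generated by the partial derivatives of `f`, then `g` is
obtained from `f` by a change of coordinates tangent to the identity. -/
theorem exists_comp_eventuallyEq {f g : EuclideanSpace ℂ (Fin n) → ℂ} (hf : AnalyticAt ℂ f 0)
    (hf' : fderiv ℂ f 0 = 0) {H : Fin n → Fin n → EuclideanSpace ℂ (Fin n) → ℂ}
    (hH : ∀ i j, AnalyticAt ℂ (H i j) 0 ∧ H i j 0 = 0)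
    (hfg : ∀ᶠ z in 𝓝 0, f z - g z = ∑ i, ∑ j, H i j z *
      fderiv ℂ f z (EuclideanSpace.single i 1) * fderiv ℂ f z (EuclideanSpace.single j 1)) :
    ∃ φ : EuclideanSpace ℂ (Fin n) → EuclideanSpace ℂ (Fin n), AnalyticAt ℂ φ 0 ∧ φ 0 = 0 ∧
      HasFDerivAt φ (ContinuousLinearMap.id ℂ (EuclideanSpace ℂ (Fin n))) 0 ∧
      ∀ᶠ z in 𝓝 0, f (φ z) = g z := by
  obtain ⟨R, hR, hRf⟩ := hf.exists_second_increment_eq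
  let e : Fin n → EuclideanSpace ℂ (Fin n) := fun i => EuclideanSpace.single i 1
  let a : Fin n → EuclideanSpace ℂ (Fin n) → ℂ := fun i z => fderiv ℂ f z (e i)
  have ha : ∀ i, AnalyticAt ℂ (a i) 0 := fun i =>
    AnalyticAt.continuousLinearMap_apply hf.fderiv analyticAt_const
  have ha0 : ∀ i, a i 0 = 0 := fun i => by simp [a, hf']
  let v : EuclideanSpace ℂ (Fin n) × (Fin n → Fin n → ℂ) → EuclideanSpace ℂ (Fin n) :=
    fun x => ∑ i, (∑ j, x.2 i j * a j x.1) • e i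
  let M : Fin n → Fin n → EuclideanSpace ℂ (Fin n) × (Fin n → Fin n → ℂ) →L[ℂ] ℂ := fun i j =>
    (ContinuousLinearMap.proj j).comp ((ContinuousLinearMap.proj i).comp
      (ContinuousLinearMap.snd ℂ (EuclideanSpace ℂ (Fin n)) (Fin n → Fin n → ℂ)))
  have hv : AnalyticAt ℂ v 0 := by
    refine Finset.analyticAt_fun_sum _ fun i _ => AnalyticAt.fun_smul ?_ analyticAt_const
    exact Finset.analyticAt_fun_sum _ fun j _ => ((M i j).analyticAt 0).mul
      (AnalyticAt.comp_of_eq (ha j) analyticAt_fst rfl)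
  have hv0 : v 0 = 0 := by simp [v]
  let S : Fin n → Fin n → EuclideanSpace ℂ (Fin n) × (Fin n → Fin n → ℂ) → ℂ :=
    fun k l x => R (x.1, v x) (e k) (e l)
  have hS : ∀ k l, AnalyticAt ℂ (S k l) 0 := fun k l =>
    AnalyticAt.continuousLinearMap_apply (AnalyticAt.continuousLinearMap_apply
      (AnalyticAt.comp_of_eq hR (analyticAt_fst.prod hv) (by simp [hv0])) analyticAt_const)
      analyticAt_const
  let B : EuclideanSpace ℂ (Fin n) × (Fin n → Fin n → ℂ) → Fin n → Fin n → ℂ := fun x i j =>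
    -((∑ k, ∑ l, S k l x * x.2 k i * x.2 l j) + H i j x.1)
  have hB : AnalyticAt ℂ B 0 := by
    refine AnalyticAt.pi fun i => AnalyticAt.pi fun j => ((Finset.analyticAt_fun_sum _ fun k _ =>
      Finset.analyticAt_fun_sum _ fun l _ => ?_).add ?_).neg
    · exact ((hS k l).mul ((M k i).analyticAt 0)).mul ((M l j).analyticAt 0)
    · exact AnalyticAt.comp_of_eq (hH i j).1 analyticAt_fst rfl
  have hB0 : B 0 = 0 := by
    ext i j
    simp [B, (hH i j).2]
  have hB' : HasFDerivAt (fun y => B (0, y)) (0 : (Fin n → Fin n → ℂ) →L[ℂ] _) 0 := by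
    have hd : ∀ i j, HasFDerivAt (fun y => B (0, y) i j) (0 : (Fin n → Fin n → ℂ) →L[ℂ] ℂ) 0 := by
      intro i j
      have h1 : HasFDerivAt (fun y : Fin n → Fin n → ℂ =>
          ∑ k, ∑ l, S k l (0, y) * y k i * y l j)
          (∑ _k : Fin n, ∑ _l : Fin n, (0 : (Fin n → Fin n → ℂ) →L[ℂ] ℂ)) 0 := by
        refine HasFDerivAt.fun_sum fun k _ => HasFDerivAt.fun_sum fun l _ => ?_
        have hs : DifferentiableAt ℂ (fun y : Fin n → Fin n → ℂ => S k l (0, y)) 0 :=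
          (AnalyticAt.comp_of_eq (hS k l) (analyticAt_const.prod analyticAt_id) rfl).differentiableAt
        refine HasFDerivAt.mul_of_eq_zero (hs.mul (by fun_prop)) (by fun_prop) (by simp) (by simp)
      simp only [Finset.sum_const_zero] at h1
      have h2 := (h1.add_const (H i j 0)).neg
      rw [neg_zero] at h2
      exact h2
    exact hasFDerivAt_pi'.2 fun i => hasFDerivAt_pi'.2 fun j => hd i j
  obtain ⟨ψ, hψ, hψ0, hψB⟩ := hB.exists_implicit_solution hB0 hB'
  have hw : AnalyticAt ℂ (fun z => v (z, ψ z)) 0 :=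
    AnalyticAt.comp_of_eq (f := fun z => (z, ψ z)) hv (analyticAt_id.prod hψ) (by simp [hψ0])
  have hw0 : v (0, ψ 0) = 0 := by
    rw [hψ0]
    exact hv0
  have hw' : HasFDerivAt (fun z => v (z, ψ z))
      (0 : EuclideanSpace ℂ (Fin n) →L[ℂ] EuclideanSpace ℂ (Fin n)) 0 := by
    have h1 : HasFDerivAt (fun z => v (z, ψ z)) (∑ i : Fin n, (∑ _j : Fin n,
        (0 : EuclideanSpace ℂ (Fin n) →L[ℂ] ℂ)).smulRight (e i)) 0 := by
      refine HasFDerivAt.fun_sum fun i _ => HasFDerivAt.smul_const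
        (HasFDerivAt.fun_sum fun j _ => ?_) _
      refine HasFDerivAt.mul_of_eq_zero ?_ (ha j).differentiableAt (by simp [hψ0]) (ha0 j)
      exact differentiableAt_pi.1 (differentiableAt_pi.1 hψ.differentiableAt i) j
    simpa using h1
  refine ⟨fun z => z + v (z, ψ z), analyticAt_id.add hw, by simp [hw0], ?_, ?_⟩
  · have h1 := (hasFDerivAt_id (𝕜 := ℂ) (0 : EuclideanSpace ℂ (Fin n))).add hw'
    rw [add_zero] at h1
    exact h1
  · have h1 : Filter.Tendsto (fun z => (z, v (z, ψ z))) (𝓝 0)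
        (𝓝 (0 : EuclideanSpace ℂ (Fin n) × EuclideanSpace ℂ (Fin n))) := by
      have h2 := (continuousAt_id.prodMk hw.continuousAt).tendsto
      rw [hw0] at h2
      exact h2
    filter_upwards [h1.eventually hRf, hψB, hfg] with z hz hzψ hzg
    rw [hz]
    set V := v (z, ψ z) with hV
    have h2 : V = ∑ i, (∑ j, ψ z i j * a j z) • e i := rfl
    have h3 : fderiv ℂ f z V = ∑ i, ∑ j, ψ z i j * (a i z * a j z) := by
      rw [h2, map_sum]
      refine Finset.sum_congr rfl fun i _ => ?_
      rw [map_smul, smul_eq_mul, Finset.sum_mul]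
      exact Finset.sum_congr rfl fun j _ => by ring
    have h4 : R (z, V) V V = ∑ k, ∑ l, S k l (z, ψ z) *
        ((∑ i, ψ z k i * a i z) * (∑ j, ψ z l j * a j z)) := by
      have h5 : ∀ T : EuclideanSpace ℂ (Fin n) →L[ℂ] EuclideanSpace ℂ (Fin n) →L[ℂ] ℂ,
          T V V = ∑ k, ∑ l, T (e k) (e l) *
            ((∑ i, ψ z k i * a i z) * (∑ j, ψ z l j * a j z)) := by
        intro T
        rw [h2]
        simp only [map_sum, map_smul, _root_.sum_apply, smul_apply, smul_eq_mul,
          Finset.sum_mul, Finset.mul_sum]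
        rw [Finset.sum_comm]
        refine Finset.sum_congr rfl fun k _ => Finset.sum_congr rfl fun l _ => ?_
        rw [Finset.sum_comm]
        exact Finset.sum_congr rfl fun j _ => Finset.sum_congr rfl fun i _ => by ring
      exact h5 _
    have h5 : R (z, V) V V = ∑ i, ∑ j, (∑ k, ∑ l, S k l (z, ψ z) * ψ z k i * ψ z l j) *
        (a i z * a j z) := by
      rw [h4]
      simp only [Finset.sum_mul, Finset.mul_sum]
      rw [sum_sum_sum_sum_comm]
      refine Finset.sum_congr rfl fun i _ => Finset.sum_congr rfl fun j _ =>
        Finset.sum_congr rfl fun k _ => Finset.sum_congr rfl fun l _ => by ring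
    have h6 : f z - g z = ∑ i, ∑ j, H i j z * (a i z * a j z) := by
      rw [hzg]
      simp only [a, e, mul_assoc]
    have h7 : ∀ i j, ψ z i j + (∑ k, ∑ l, S k l (z, ψ z) * ψ z k i * ψ z l j) + H i j z = 0 := by
      intro i j
      have := congrFun (congrFun hzψ i) j
      simp only [B] at this
      linear_combination this
    have h8 : fderiv ℂ f z V + R (z, V) V V + (f z - g z) = 0 := by
      rw [h3, h5, h6]
      simp only [← Finset.sum_add_distrib, ← add_mul, h7, zero_mul, Finset.sum_const_zero]
    linear_combination h8

end Tougeron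

section LocalEquivalence

open scoped ContDiff

variable {E : Type*} [NormedAddCommGroup E] [NormedSpace ℂ E] [CompleteSpace E]

/-- A change of coordinates tangent to the identity identifies the zero sets of `f` and `f ∘ φ`. -/
theorem exists_analytic_equiv_zero_set {f g : E → ℂ} {φ : E → E} (hφ : AnalyticAt ℂ φ 0)
    (hφ0 : φ 0 = 0) (hφ' : HasFDerivAt φ (ContinuousLinearMap.id ℂ E) 0)
    (hfg : ∀ᶠ z in 𝓝 0, f (φ z) = g z) :
    ∃ U U' : Set E, U ∈ 𝓝 (0 : E) ∧ U' ∈ 𝓝 (0 : E) ∧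
      ∃ φ ψ : E → E, φ 0 = 0 ∧
        (∀ z ∈ U, AnalyticAt ℂ φ z) ∧ (∀ z ∈ U', AnalyticAt ℂ ψ z) ∧
        Set.MapsTo φ U U' ∧ Set.MapsTo ψ U' U ∧
        (∀ z ∈ U, ψ (φ z) = z) ∧ (∀ z ∈ U', φ (ψ z) = z) ∧
        φ '' (f ⁻¹' {0} ∩ U) = g ⁻¹' {0} ∩ U' := by
  have h1 : ContDiffAt ℂ ω φ 0 := hφ.contDiffAt
  have h2 : HasFDerivAt φ ((ContinuousLinearEquiv.refl ℂ E : E ≃L[ℂ] E) : E →L[ℂ] E) 0 := hφ'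
  let e := h1.toOpenPartialHomeomorph φ h2 (by simp)
  have hs : (0 : E) ∈ e.source := h1.mem_toOpenPartialHomeomorph_source h2 (by simp)
  have ht : (0 : E) ∈ e.target := by
    have := e.map_source hs
    rwa [show e 0 = 0 from hφ0] at this
  have he0 : e.symm 0 = 0 := by
    have := e.left_inv hs
    rwa [show e 0 = 0 from hφ0] at this
  have hsymm : AnalyticAt ℂ e.symm 0 := by
    have h3 := h1.to_localInverse h2 (by simp)
    rw [hφ0] at h3
    exact h3.analyticAt
  set S : Set E := {z | z ∈ e.source ∧ AnalyticAt ℂ φ z ∧ f (φ z) = g z ∧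
    AnalyticAt ℂ e.symm (φ z)} with hS
  have hS0 : S ∈ 𝓝 (0 : E) := by
    have h4 : ∀ᶠ z in 𝓝 0, AnalyticAt ℂ e.symm (φ z) := by
      have h5 := hφ.continuousAt.tendsto
      rw [hφ0] at h5
      exact h5.eventually hsymm.eventually_analyticAt
    filter_upwards [e.open_source.mem_nhds hs, hφ.eventually_analyticAt, hfg, h4] with z a b c d
    exact ⟨a, b, c, d⟩
  refine ⟨e.target ∩ e.symm ⁻¹' S, S, ?_, hS0, e.symm, φ, he0, ?_, fun z hz => hz.2.1,
    fun z hz => hz.2, fun z hz => ⟨e.map_source hz.1, ?_⟩, fun z hz => e.right_inv hz.1,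
    fun z hz => e.left_inv hz.1, ?_⟩
  · refine Filter.inter_mem (e.open_target.mem_nhds ht) (hsymm.continuousAt.preimage_mem_nhds ?_)
    rwa [he0]
  · rintro z ⟨hz, hz'⟩
    have h3 := hz'.2.2.2
    rwa [show φ (e.symm z) = z from e.right_inv hz] at h3
  · rw [Set.mem_preimage, show e.symm (φ z) = z from e.left_inv hz.1]
    exact hz
  · ext w
    constructor
    · rintro ⟨z, ⟨hfz, hz, hz'⟩, rfl⟩
      refine ⟨?_, hz'⟩
      have h3 := hz'.2.2.1
      rw [show φ (e.symm z) = z from e.right_inv hz] at h3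
      rw [Set.mem_preimage, ← h3]
      exact hfz
    · rintro ⟨hgw, hw⟩
      refine ⟨φ w, ⟨?_, e.map_source hw.1, ?_⟩, e.left_inv hw.1⟩
      · rw [Set.mem_preimage, hw.2.2.1]
        exact hgw
      · rw [Set.mem_preimage, show e.symm (φ w) = w from e.left_inv hw.1]
        exact hw

end LocalEquivalence

/-- Samuel. -/
theorem samuel_algebraicity {n : ℕ}
    (f : En n → ℂ) (hf : AnalyticAt ℂ f 0) (hf0 : f 0 = 0)
    (hfsing : IsolatedSingularityAt0 f)
    -- Taylor expansion of `f` at `0`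
    (p : FormalMultilinearSeries ℂ (En n) ℂ) (hp : HasFPowerSeriesAt f p 0) :
    ∃ N : ℕ, 0 < N ∧
      -- `V_f` is analytically equivalent to `V_g`, `g` the degree-`N` Taylor polynomial
      ∃ U U' : Set (En n), U ∈ 𝓝 (0 : En n) ∧ U' ∈ 𝓝 (0 : En n) ∧
        ∃ φ ψ : En n → En n, φ 0 = 0 ∧
          (∀ z ∈ U, AnalyticAt ℂ φ z) ∧ (∀ z ∈ U', AnalyticAt ℂ ψ z) ∧
          Set.MapsTo φ U U' ∧ Set.MapsTo ψ U' U ∧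
          (∀ z ∈ U, ψ (φ z) = z) ∧ (∀ z ∈ U', φ (ψ z) = z) ∧
          φ '' (f ⁻¹' {0} ∩ U) =
            (fun z : En n => ∑ j ∈ Finset.range (N + 1), (p j fun _ => z)) ⁻¹' {0} ∩ U' := by
  let a : Fin n → analyticRing (En n) := fun i =>
    ⟨fun z => fderiv ℂ f z (EuclideanSpace.single i 1),
      AnalyticAt.continuousLinearMap_apply hf.fderiv analyticAt_const⟩
  obtain ⟨hf', V, hV, hfV⟩ := hfsing
  obtain ⟨N, hN, h⟩ := exists_order_forall_eq_sum a (by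
    filter_upwards [hV] with z hz hza
    by_contra hz0
    refine hfV z hz hz0 (ContinuousLinearMap.coe_injective
      ((EuclideanSpace.basisFun (Fin n) ℂ).toBasis.ext fun i => ?_))
    simpa [a] using hza i)
  obtain ⟨H, hH, hHf⟩ := h _ _ (hp.tail (N + 1)) fun j hj => if_pos hj
  obtain ⟨φ, hφ, hφ0, hφ', hφf⟩ := exists_comp_eventuallyEq hf hf' hH hHf
  exact ⟨N, hN, exists_analytic_equiv_zero_set hφ hφ0 hφ' hφf⟩
end
end

section
/- (Risler–Trotman) Let f, g : (ℂ^n,0) → (ℂ,0) be germs of holomorphic functions with isolated singularity at the origin. Suppose f and g are right-left bilipschitz equivalent: there exist a germ of bilipschitz homeomorphism φ : (ℂ^n,0) → (ℂ^n,0) and a germ of bilipschitz homeomorphism ψ : (ℂ,0) → (ℂ,0) such that f = ψ ∘ g ∘ φ on a neighborhood of 0. Then the algebraic multiplicities of f and g are equal: m_f = m_g. -/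
open scoped Topology

set_option synthInstance.maxHeartbeats 1000000
set_option maxHeartbeats 1000000

noncomputable section

/-- A Lipschitz map on a neighborhood of `0` fixing `0` is `O(‖x‖)` at `0`. -/
theorem LipschitzOnWith.isBigO_norm_zero {E F : Type*} [SeminormedAddCommGroup E]
    [SeminormedAddCommGroup F] {K : NNReal} {φ : E → F} {U : Set E}
    (hφ : LipschitzOnWith K φ U) (hU : U ∈ 𝓝 (0 : E)) (h0 : φ 0 = 0) :
    φ =O[𝓝 0] fun x => ‖x‖ := by
  refine Asymptotics.IsBigO.of_bound K ?_
  filter_upwards [hU] with x hx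
  simpa [h0, dist_zero_right] using hφ.dist_le_mul x hx 0 (mem_of_mem_nhds hU)

/-- A Lipschitz map on a neighborhood of `0` fixing `0` tends to `0` at `0`. -/
theorem LipschitzOnWith.tendsto_zero {E F : Type*} [SeminormedAddCommGroup E]
    [SeminormedAddCommGroup F] {K : NNReal} {φ : E → F} {U : Set E}
    (hφ : LipschitzOnWith K φ U) (hU : U ∈ 𝓝 (0 : E)) (h0 : φ 0 = 0) :
    Filter.Tendsto φ (𝓝 0) (𝓝 0) := by
  simpa [ContinuousAt, h0] using hφ.continuousOn.continuousAt hU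

theorem HasInitialTerm.isBigO_norm_pow {n : ℕ} {f : En n → ℂ} {ν : ℕ} {P : En n → ℂ}
    (h : HasInitialTerm f ν P) : f =O[𝓝 0] fun z => ‖z‖ ^ ν := by
  obtain ⟨p, hp, hlow, -, -⟩ := h
  refine (hp.isBigO_sub_partialSum_pow ν).congr_left fun z => ?_
  rw [zero_add, FormalMultilinearSeries.partialSum,
    Finset.sum_eq_zero fun k hk => hlow k (Finset.mem_range.1 hk) z, sub_zero]

theorem HasInitialTerm.le_of_isBigO_norm_pow {n : ℕ} {f : En n → ℂ} {ν μ : ℕ} {P : En n → ℂ}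
    (h : HasInitialTerm f ν P) (hf : f =O[𝓝 0] fun z => ‖z‖ ^ μ) : μ ≤ ν := by
  obtain ⟨p, hp, hlow, hP, hne⟩ := h
  by_contra! hlt
  have hpow : (fun z : En n => ‖z‖ ^ μ) =O[𝓝 0] fun z => ‖z‖ ^ (ν + 1) := by
    refine Asymptotics.IsBigO.of_bound 1 ?_
    filter_upwards [Metric.ball_mem_nhds (0 : En n) one_pos] with z hz
    have hz1 : ‖z‖ ≤ 1 := (mem_ball_zero_iff.1 hz).le
    simpa using pow_le_pow_of_le_one (norm_nonneg z) hz1 hlt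
  have hsum : (fun z : En n => p ν fun _ => z) =O[𝓝 0] fun z => ‖z‖ ^ (ν + 1) := by
    refine ((hf.trans hpow).sub (hp.isBigO_sub_partialSum_pow (ν + 1))).congr_left fun z => ?_
    rw [zero_add, sub_sub_cancel, FormalMultilinearSeries.partialSum, Finset.sum_range_succ,
      Finset.sum_eq_zero fun k hk => hlow k (Finset.mem_range.1 hk) z, zero_add]
  exact hne <| funext fun z => (hP z).trans (hsum.continuousMultilinearMap_apply_eq_zero z)

/-- If `f = ψ ∘ g ∘ φ` near `0` with `φ` and `ψ` Lipschitz near `0` and fixing `0`, then the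
multiplicity of `f` is at least that of `g`. -/
theorem HasInitialTerm.le_of_eventuallyEq_comp {n : ℕ} {f g : En n → ℂ} {ν ν' : ℕ}
    {P Q : En n → ℂ} (hf : HasInitialTerm f ν P) (hg : HasInitialTerm g ν' Q)
    (hgt : Filter.Tendsto g (𝓝 0) (𝓝 0))
    {U : Set (En n)} (hU : U ∈ 𝓝 (0 : En n)) {φ : En n → En n} (hφ0 : φ 0 = 0)
    {K : NNReal} (hφ : LipschitzOnWith K φ U)
    {W : Set ℂ} (hW : W ∈ 𝓝 (0 : ℂ)) {ψ : ℂ → ℂ} (hψ0 : ψ 0 = 0)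
    {L : NNReal} (hψ : LipschitzOnWith L ψ W)
    (heq : ∀ᶠ z in 𝓝 (0 : En n), f z = ψ (g (φ z))) : ν' ≤ ν := by
  have hφt := hφ.tendsto_zero hU hφ0
  refine hf.le_of_isBigO_norm_pow (Filter.EventuallyEq.trans_isBigO heq ?_)
  exact ((hψ.isBigO_norm_zero hW hψ0).comp_tendsto (hgt.comp hφt)).of_norm_right.trans
    ((hg.isBigO_norm_pow.comp_tendsto hφt).trans ((hφ.isBigO_norm_zero hU hφ0).norm_left.pow ν'))

/-- Risler–Trotman. -/
theorem risler_trotman {n : ℕ}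
    (f g : En n → ℂ) (hf : AnalyticAt ℂ f 0) (hg : AnalyticAt ℂ g 0)
    (hf0 : f 0 = 0) (hg0 : g 0 = 0)
    (hfsing : IsolatedSingularityAt0 f) (hgsing : IsolatedSingularityAt0 g)
    -- `ν` and `ν'` are the algebraic multiplicities of `f` and `g`
    (ν ν' : ℕ) (P Q : En n → ℂ)
    (hfi : HasInitialTerm f ν P) (hgi : HasInitialTerm g ν' Q)
    -- a germ of bilipschitz homeomorphism `φ` of `(ℂⁿ,0)`
    (U V : Set (En n)) (hU : U ∈ 𝓝 (0 : En n)) (hV : V ∈ 𝓝 (0 : En n))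
    (φ φinv : En n → En n) (hφ0 : φ 0 = 0)
    (K K' : NNReal) (hφlip : LipschitzOnWith K φ U) (hφinvlip : LipschitzOnWith K' φinv V)
    (hφm : Set.MapsTo φ U V) (hφm' : Set.MapsTo φinv V U)
    (hφinv1 : ∀ z ∈ U, φinv (φ z) = z) (hφinv2 : ∀ z ∈ V, φ (φinv z) = z)
    -- a germ of bilipschitz homeomorphism `ψ` of `(ℂ,0)`
    (W W' : Set ℂ) (hW : W ∈ 𝓝 (0:ℂ)) (hW' : W' ∈ 𝓝 (0:ℂ))
    (ψ ψinv : ℂ → ℂ) (hψ0 : ψ 0 = 0)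
    (L L' : NNReal) (hψlip : LipschitzOnWith L ψ W) (hψinvlip : LipschitzOnWith L' ψinv W')
    (hψm : Set.MapsTo ψ W W') (hψm' : Set.MapsTo ψinv W' W)
    (hψinv1 : ∀ z ∈ W, ψinv (ψ z) = z) (hψinv2 : ∀ z ∈ W', ψ (ψinv z) = z)
    -- `f = ψ ∘ g ∘ φ` on a neighborhood of `0`
    (heq : ∀ᶠ z in 𝓝 (0 : En n), f z = ψ (g (φ z))) :
    ν = ν' := by
  have hft : Filter.Tendsto f (𝓝 0) (𝓝 0) := by simpa [ContinuousAt, hf0] using hf.continuousAt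
  have hgt : Filter.Tendsto g (𝓝 0) (𝓝 0) := by simpa [ContinuousAt, hg0] using hg.continuousAt
  have hφinv0 : φinv 0 = 0 := by simpa [hφ0] using hφinv1 0 (mem_of_mem_nhds hU)
  have hψinv0 : ψinv 0 = 0 := by simpa [hψ0] using hψinv1 0 (mem_of_mem_nhds hW)
  refine le_antisymm ?_ (hfi.le_of_eventuallyEq_comp hgi hgt hU hφ0 hφlip hW hψ0 hψlip heq)
  refine hgi.le_of_eventuallyEq_comp hfi hft hV hφinv0 hφinvlip hW' hψinv0 hψinvlip ?_
  filter_upwards [(hφinvlip.tendsto_zero hV hφinv0).eventually heq, hV, hgt hW] with w hw hwV hwW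
  rw [hw, hφinv2 w hwV, hψinv1 _ hwW]
end
end
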